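/- arXiv:1107.4490 — 4 statements merged into one kernel-verified Lean document; each statement's English description precedes it below -/
import Mathlib

section
/- Let N ≥ 1, let 0 < λ₁ < λ₂ < ⋯ < λ_N be real numbers, and let m > 0. Then there exist positive masses m₁,…,m_N and positive spring constants k₁,…,k_{N+1} such that (i) m₁ + ⋯ + m_N = m, (ii) the system is persymmetric (m_i = m_{N+1−i} for all 1 ≤ i ≤ N and k_i = k_{N+2−i} for all 1 ≤ i ≤ N+1), and (iii) the eigenvalues of the matrix D⁻¹ K D⁻¹ are exactly λ₁,…,λ_N (i.e., its characteristic polynomial is ∏_{j=1}^{N}(X − λ_j)). -/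
open Matrix Polynomial

/-- The stiffness matrix of a mass–spring chain with spring constants
`ks 0, …, ks N` (0-indexed version of `k₁, …, k_{N+1}`):
`K_{ii} = kᵢ + kᵢ₊₁`, `K_{i,i+1} = K_{i+1,i} = −kᵢ₊₁`, zero elsewhere. -/
noncomputable def stiffness (N : ℕ) (ks : Fin (N + 1) → ℝ) :
    Matrix (Fin N) (Fin N) ℝ :=
  Matrix.of fun i j =>
    if i = j then ks i.castSucc + ks i.succ
    else if (i : ℕ) + 1 = (j : ℕ) then -(ks j.castSucc)
    else if (j : ℕ) + 1 = (i : ℕ) then -(ks i.castSucc)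
    else 0

/-- The mass-normalized stiffness matrix `D⁻¹ K D⁻¹`, where
`D = diag(√m₁, …, √m_N)`. -/
noncomputable def normStiff (N : ℕ) (ms : Fin N → ℝ) (ks : Fin (N + 1) → ℝ) :
    Matrix (Fin N) (Fin N) ℝ :=
  Matrix.diagonal (fun i => (Real.sqrt (ms i))⁻¹) * stiffness N ks *
    Matrix.diagonal (fun i => (Real.sqrt (ms i))⁻¹)

lemma prod_sub_swap (n : ℕ) (f : ℕ → ℝ) (x : ℝ) :
    ∏ i ∈ Finset.range n, (f i - x) = (-1) ^ n * ∏ i ∈ Finset.range n, (x - f i) := by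
  induction n with
  | zero => simp
  | succ n ih => rw [Finset.prod_range_succ, Finset.prod_range_succ, ih]; ring

/-- A polynomial vanishing at `n` distinct points which is the difference of two monic split
polynomials of degree `n + 1` is a multiple of the product of the corresponding linear factors. -/
lemma exists_prod_sub_prod_eq (n : ℕ) (a b c : ℕ → ℝ)
    (hc : ∀ i < n, ∀ j < n, i ≠ j → c i ≠ c j)
    (h0 : ∀ i < n, ∏ j ∈ Finset.range (n + 1), (c i - a j) =
      ∏ j ∈ Finset.range (n + 1), (c i - b j)) :
    ∃ γ : ℝ, ∀ x, ∏ j ∈ Finset.range (n + 1), (x - a j) - ∏ j ∈ Finset.range (n + 1), (x - b j) =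
      γ * ∏ j ∈ Finset.range n, (x - c j) := by
  set A : ℝ[X] := ∏ j ∈ Finset.range (n + 1), (X - C (a j)) with hA
  set B : ℝ[X] := ∏ j ∈ Finset.range (n + 1), (X - C (b j)) with hB
  set P : ℝ[X] := ∏ j ∈ Finset.range n, (X - C (c j)) with hP
  have hAm : A.Monic := monic_prod_of_monic _ _ fun i _ => monic_X_sub_C _
  have hBm : B.Monic := monic_prod_of_monic _ _ fun i _ => monic_X_sub_C _
  have hPm : P.Monic := monic_prod_of_monic _ _ fun i _ => monic_X_sub_C _
  have hAd : A.natDegree = n + 1 := by simp [hA]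
  have hBd : B.natDegree = n + 1 := by simp [hB]
  have hPd : P.natDegree = n := by simp [hP]
  have hdvd : P ∣ A - B := by
    refine Finset.prod_dvd_of_coprime ?_ ?_
    · intro i hi j hj hij
      simp only [Finset.coe_range, Set.mem_Iio] at hi hj
      exact isCoprime_X_sub_C_of_isUnit_sub (sub_ne_zero.2 (hc i hi j hj hij)).isUnit
    · intro i hi
      rw [dvd_iff_isRoot, IsRoot.def, eval_sub, hA, hB, eval_prod, eval_prod]
      simpa [sub_eq_zero] using h0 i (Finset.mem_range.1 hi)
  obtain ⟨E, hE⟩ := hdvd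
  have hEd : E.natDegree = 0 := by
    by_cases hE0 : E = 0
    · simp [hE0]
    · have hlt : (A - B).degree < A.degree := by
        refine degree_sub_lt_left ?_ hAm.ne_zero (by rw [hAm.leadingCoeff, hBm.leadingCoeff])
        rw [degree_eq_natDegree hAm.ne_zero, degree_eq_natDegree hBm.ne_zero, hAd, hBd]
      have hne : A - B ≠ 0 := by rw [hE]; exact mul_ne_zero hPm.ne_zero hE0
      have := natDegree_lt_natDegree hne hlt
      rw [hE, natDegree_mul hPm.ne_zero hE0, hAd, hPd] at this
      omega
  refine ⟨E.coeff 0, fun x => ?_⟩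
  have := congrArg (eval x) hE
  rw [eq_C_of_natDegree_eq_zero hEd] at this
  simp only [hA, hB, hP, eval_sub, eval_mul, eval_prod, eval_X, eval_C] at this
  rw [this, mul_comm]

/-- If `a₀ < b₀ < a₁ < ⋯ < aₙ < bₙ`, the difference of the two products with zeros `b` and `a`
has zeros strictly interlacing the `aᵢ`. -/
lemma exists_interlacing_difference (n : ℕ) (a b : ℕ → ℝ) (hab : ∀ i ≤ n, a i < b i)
    (hba : ∀ i < n, b i < a (i + 1)) :
    ∃ (c : ℕ → ℝ) (γ : ℝ), 0 < γ ∧ (∀ i < n, a i < c i ∧ c i < a (i + 1)) ∧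
      ∀ x, ∏ i ∈ Finset.range (n + 1), (b i - x) =
        ∏ i ∈ Finset.range (n + 1), (a i - x) + γ * ∏ i ∈ Finset.range n, (c i - x) := by
  have hmono : ∀ i j, i ≤ j → j ≤ n → a i ≤ a j := by
    intro i j hij
    induction j, hij using Nat.le_induction with
    | base => intro _; exact le_rfl
    | succ j _ ih =>
      intro hj
      linarith [ih (by omega), hab j (by omega), hba j (by omega)]
  have hlt : ∀ i j, i ≤ j → j ≤ n → a i < b j := fun i j hij hj =>
    (hmono i j hij hj).trans_lt (hab j hj)
  have hgt : ∀ j i, j < i → i ≤ n → b j < a i := fun j i hji hi =>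
    (hba j (by omega)).trans_le (hmono _ _ hji hi)
  set F : ℝ → ℝ := fun x =>
    ∏ j ∈ Finset.range (n + 1), (x - a j) - ∏ j ∈ Finset.range (n + 1), (x - b j) with hF
  have hFc : Continuous F := by fun_prop
  have hFa : ∀ i ≤ n, F (a i) = -∏ j ∈ Finset.range (n + 1), (a i - b j) := by
    intro i hi
    have : ∏ j ∈ Finset.range (n + 1), (a i - a j) = 0 :=
      Finset.prod_eq_zero (Finset.mem_range.2 (by omega : i < n + 1)) (sub_self _)
    simp only [hF, this, zero_sub]
  have hneg : ∀ i < n, F (a i) * F (a (i + 1)) < 0 := by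
    intro i hi
    rw [hFa i hi.le, hFa (i + 1) hi, neg_mul_neg, ← Finset.prod_mul_distrib,
      ← Finset.mul_prod_erase _ _ (Finset.mem_range.2 (by omega : i < n + 1))]
    refine mul_neg_of_neg_of_pos ?_ (Finset.prod_pos fun j hj => ?_)
    · exact mul_neg_of_neg_of_pos (by linarith [hab i hi.le]) (by linarith [hba i hi])
    · rw [Finset.mem_erase, Finset.mem_range] at hj
      rcases lt_or_gt_of_ne hj.1 with h | h
      · exact mul_pos (by linarith [hgt j i h hi.le]) (by linarith [hgt j (i + 1) (by omega) hi])
      · exact mul_pos_of_neg_of_neg (by linarith [hlt i j h.le (by omega)])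
          (by linarith [hlt (i + 1) j h (by omega)])
  have hex : ∀ i, ∃ c, i < n → a i < c ∧ c < a (i + 1) ∧ F c = 0 := by
    intro i
    by_cases hi : i < n
    · have hle : a i ≤ a (i + 1) := hmono i (i + 1) (by omega) hi
      rcases mul_neg_iff.1 (hneg i hi) with ⟨h1, h2⟩ | ⟨h1, h2⟩
      · obtain ⟨c, hc, hc0⟩ := intermediate_value_Ioo' hle hFc.continuousOn ⟨h2, h1⟩
        exact ⟨c, fun _ => ⟨hc.1, hc.2, hc0⟩⟩
      · obtain ⟨c, hc, hc0⟩ := intermediate_value_Ioo hle hFc.continuousOn ⟨h1, h2⟩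
        exact ⟨c, fun _ => ⟨hc.1, hc.2, hc0⟩⟩
    · exact ⟨0, fun h => absurd h hi⟩
  choose c hc using hex
  have hclt : ∀ i j, i < j → j < n → c i < c j := fun i j hij hj =>
    (hc i (by omega)).2.1.trans_le ((hmono (i + 1) j hij hj.le).trans (hc j hj).1.le)
  obtain ⟨γ, hγ⟩ := exists_prod_sub_prod_eq n a b c
    (fun i hi j hj hij => by
      rcases lt_or_gt_of_ne hij with h | h
      · exact (hclt i j h hj).ne
      · exact (hclt j i h hi).ne')
    (fun i hi => sub_eq_zero.1 (hc i hi).2.2)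
  have hkey : ∀ x, ∏ i ∈ Finset.range (n + 1), (b i - x) =
        ∏ i ∈ Finset.range (n + 1), (a i - x) + γ * ∏ i ∈ Finset.range n, (c i - x) := by
    intro x
    rw [prod_sub_swap, prod_sub_swap, prod_sub_swap]
    linear_combination (-1) ^ n * hγ x
  refine ⟨c, γ, ?_, fun i hi => ⟨(hc i hi).1, (hc i hi).2.1⟩, hkey⟩
  have hn := hkey (a n)
  rw [Finset.prod_eq_zero (f := fun i => a i - a n) (Finset.mem_range.2 (Nat.lt_succ_self n))
    (sub_self _), zero_add, Finset.prod_range_succ] at hn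
  have hpos : 0 < ∏ i ∈ Finset.range n, ((b i - a n) * (c i - a n)) := by
    refine Finset.prod_pos fun i hi => ?_
    rw [Finset.mem_range] at hi
    refine mul_pos_of_neg_of_neg (by linarith [hgt i n hi le_rfl]) ?_
    linarith [(hc i hi).2.1, hmono (i + 1) n hi le_rfl]
  rw [Finset.prod_mul_distrib] at hpos
  have hbn : 0 < b n - a n := by linarith [hab n le_rfl]
  have hγP : 0 < γ * (∏ i ∈ Finset.range n, (c i - a n)) ^ 2 := by
    have := mul_pos hbn hpos
    calc 0 < _ := this
      _ = _ := by linear_combination (∏ i ∈ Finset.range n, (c i - a n)) * hn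
  exact pos_of_mul_pos_left hγP (sq_nonneg _)

/-- The coefficient of the transfer recursion: even steps cross a spring of compliance `a`,
odd steps cross a mass `a` at squared frequency `x`. -/
def transferCoeff (i : ℕ) (a x : ℝ) : ℝ := if Even i then a else -(x * a)

/-- The pair `(p, q)` is the end of a sequence of displacements (even indices) and forces
(odd indices), starting from a fixed wall and crossing `N + 1` springs and masses alternately. -/
def IsTransferPair (N : ℕ) (p q : ℝ → ℝ) : Prop :=
  ∃ (a : ℕ → ℝ) (z : ℕ → ℝ → ℝ) (γ : ℝ), 0 < γ ∧ (∀ i, 0 < a i) ∧ (∀ x, z 0 x = 0) ∧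
    (∀ x, z 1 x = γ) ∧
    (∀ i ≤ N, ∀ x, z (i + 2) x = z i x + transferCoeff i (a i) x * z (i + 1) x) ∧
    z (N + 1) = p ∧ z (N + 2) = q

lemma IsTransferPair.step {N : ℕ} {r p q : ℝ → ℝ} (h : IsTransferPair N r p) {t : ℝ} (ht : 0 < t)
    (hq : ∀ x, q x = r x + transferCoeff (N + 1) t x * p x) : IsTransferPair (N + 1) p q := by
  obtain ⟨a, z, γ, hγ, ha, hz0, hz1, hz, hr, hp⟩ := h
  refine ⟨fun i => if i ≤ N then a i else t, fun i => if i ≤ N + 2 then z i else q, γ, hγ,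
    ?_, ?_, ?_, ?_, ?_, ?_⟩
  · intro i
    dsimp only
    split_ifs
    exacts [ha i, ht]
  · intro x; simpa using hz0 x
  · intro x; simpa using hz1 x
  · intro i hi x
    rcases Nat.le_succ_iff.1 hi with h | rfl
    · simpa [h, show i ≤ N + 2 by omega, show i + 1 ≤ N + 2 by omega] using hz i h x
    · simp [hr, hp, hq]
  · simp [hp]
  · simp

lemma isTransferPair_odd_of_even {n : ℕ}
    (ih : ∀ (a b : ℕ → ℝ) (α β : ℝ), 0 < α → 0 < β → (∀ i < n, 0 < a i ∧ a i < b i) →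
      (∀ i, i + 1 < n → b i < a (i + 1)) →
      IsTransferPair (2 * n) (fun x => α * ∏ i ∈ Finset.range n, (a i - x))
        (fun x => β * ∏ i ∈ Finset.range n, (b i - x)))
    (a b : ℕ → ℝ) {α β : ℝ} (hα : 0 < α) (hβ : 0 < β) (hb : ∀ i ≤ n, 0 < b i)
    (hab : ∀ i < n, b i < a i ∧ a i < b (i + 1)) :
    IsTransferPair (2 * n + 1) (fun x => α * ∏ i ∈ Finset.range n, (a i - x))
      (fun x => β * ∏ i ∈ Finset.range (n + 1), (b i - x)) := by
  let a' : ℕ → ℝ := fun i => Nat.casesOn i 0 a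
  obtain ⟨c, γ, hγ, hc, hprod⟩ := exists_interlacing_difference n a' b
    (fun i hi => by
      cases i with
      | zero => exact hb 0 hi
      | succ i => exact (hab i hi).2)
    (fun i hi => (hab i hi).1)
  have ha' : ∀ i ≤ n, 0 ≤ a' i := by
    intro i hi
    cases i with
    | zero => exact le_rfl
    | succ i => exact ((hb i (by omega)).trans (hab i hi).1).le
  refine (ih c a (β * γ) α (mul_pos hβ hγ) hα
    (fun i hi => ⟨(ha' i hi.le).trans_lt (hc i hi).1, (hc i hi).2⟩)
    (fun i hi => (hc (i + 1) hi).1)).step (div_pos hβ hα) fun x => ?_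
  rw [hprod, Finset.prod_range_succ', show a' 0 = 0 from rfl]
  have hodd : ¬ Even (2 * n + 1) := by simp
  simp only [transferCoeff, hodd, if_false, a']
  field_simp
  ring

lemma isTransferPair_even_of_odd {n : ℕ}
    (ih : ∀ (a b : ℕ → ℝ) (α β : ℝ), 0 < α → 0 < β → (∀ i ≤ n, 0 < b i) →
      (∀ i < n, b i < a i ∧ a i < b (i + 1)) →
      IsTransferPair (2 * n + 1) (fun x => α * ∏ i ∈ Finset.range n, (a i - x))
        (fun x => β * ∏ i ∈ Finset.range (n + 1), (b i - x)))
    (a b : ℕ → ℝ) {α β : ℝ} (hα : 0 < α) (hβ : 0 < β)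
    (hab : ∀ i < n + 1, 0 < a i ∧ a i < b i) (hba : ∀ i, i + 1 < n + 1 → b i < a (i + 1)) :
    IsTransferPair (2 * (n + 1)) (fun x => α * ∏ i ∈ Finset.range (n + 1), (a i - x))
      (fun x => β * ∏ i ∈ Finset.range (n + 1), (b i - x)) := by
  obtain ⟨c, γ, hγ, hc, hprod⟩ := exists_interlacing_difference n a b
    (fun i hi => (hab i (by omega)).2) (fun i hi => hba i (by omega))
  refine (ih c a (β * γ) α (mul_pos hβ hγ) hα (fun i hi => (hab i (by omega)).1) hc).step
    (div_pos hβ hα) fun x => ?_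
  rw [hprod]
  have heven : Even (2 * n + 1 + 1) := ⟨n + 1, by ring⟩
  simp only [transferCoeff, heven, if_true]
  field_simp
  ring

lemma isTransferPair_even (n : ℕ) : ∀ (a b : ℕ → ℝ) (α β : ℝ), 0 < α → 0 < β →
    (∀ i < n, 0 < a i ∧ a i < b i) → (∀ i, i + 1 < n → b i < a (i + 1)) →
    IsTransferPair (2 * n) (fun x => α * ∏ i ∈ Finset.range n, (a i - x))
      (fun x => β * ∏ i ∈ Finset.range n, (b i - x)) := by
  induction n with
  | zero =>
    intro a b α β hα hβ _ _
    refine ⟨fun _ => β / α, fun i _ => if i = 0 then 0 else if i = 1 then α else β, α, hα,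
      fun _ => div_pos hβ hα, by simp, by simp, ?_, by simp, by simp⟩
    intro i hi x
    obtain rfl : i = 0 := by omega
    simp [transferCoeff, hα.ne']
  | succ n ih =>
    intro a b α β hα hβ hab hba
    exact isTransferPair_even_of_odd
      (fun a b α β hα hβ => isTransferPair_odd_of_even ih a b hα hβ) a b hα hβ hab hba

lemma exists_isTransferPair (N : ℕ) (l : ℕ → ℝ) (hpos : ∀ i < N, 0 < l i)
    (hmono : ∀ i j, i < j → j < N → l i < l j) :
    ∃ p q, IsTransferPair N p q ∧ ∀ j < N, p (l j) = 0 ∨ q (l j) = 0 := by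
  obtain ⟨n, rfl | rfl⟩ := Nat.even_or_odd' N
  · refine ⟨_, _, isTransferPair_even n (fun i => l (2 * i)) (fun i => l (2 * i + 1)) 1 1
      one_pos one_pos
      (fun i hi => ⟨hpos _ (by omega), hmono _ _ (by omega) (by omega)⟩)
      (fun i hi => hmono _ _ (by omega) (by omega)), fun j hj => ?_⟩
    obtain ⟨i, rfl | rfl⟩ := Nat.even_or_odd' j
    · left
      rw [Finset.prod_eq_zero (Finset.mem_range.2 (by omega : i < n)) (sub_self _), mul_zero]
    · right
      rw [Finset.prod_eq_zero (Finset.mem_range.2 (by omega : i < n)) (sub_self _), mul_zero]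
  · refine ⟨_, _, isTransferPair_odd_of_even (isTransferPair_even n) (fun i => l (2 * i + 1))
      (fun i => l (2 * i)) one_pos one_pos (fun i hi => hpos _ (by omega))
      (fun i hi => ⟨hmono _ _ (by omega) (by omega), hmono _ _ (by omega) (by omega)⟩),
      fun j hj => ?_⟩
    obtain ⟨i, rfl | rfl⟩ := Nat.even_or_odd' j
    · right
      rw [Finset.prod_eq_zero (Finset.mem_range.2 (by omega : i < n + 1)) (sub_self _), mul_zero]
    · left
      rw [Finset.prod_eq_zero (Finset.mem_range.2 (by omega : i < n)) (sub_self _), mul_zero]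

/-- Reflecting a half chain about its last element, whose parameter is doubled, gives a
palindromic chain for which every zero of `p` or `q` is a frequency of a standing wave. -/
lemma IsTransferPair.exists_palindrome {N : ℕ} {p q : ℝ → ℝ} (h : IsTransferPair N p q) :
    ∃ A : ℕ → ℝ, (∀ i, 0 < A i) ∧ (∀ i ≤ 2 * N, A (2 * N - i) = A i) ∧
      ∀ x, p x = 0 ∨ q x = 0 → ∃ Z : ℕ → ℝ, Z 0 = 0 ∧ 0 < Z 1 ∧ Z (2 * N + 2) = 0 ∧
        ∀ i ≤ 2 * N, Z (i + 2) = Z i + transferCoeff i (A i) x * Z (i + 1) := by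
  obtain ⟨a, z, γ, hγ, ha, hz0, hz1, hz, hp, hq⟩ := h
  let A : ℕ → ℝ := fun i => if i < N then a i else if i = N then 2 * a N else a (2 * N - i)
  refine ⟨A, ?_, ?_, ?_⟩
  · intro i
    dsimp only [A]
    split_ifs
    exacts [ha i, mul_pos two_pos (ha N), ha _]
  · intro i hi
    dsimp only [A]
    rcases lt_trichotomy i N with h | rfl | h
    · rw [if_neg (by omega), if_neg (by omega), if_pos h]
      congr 1; omega
    · simp [show 2 * i - i = i by omega]
    · rw [if_pos (by omega), if_neg (by omega), if_neg (by omega)]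
  · intro x hx
    obtain ⟨σ, hσ1, hσ2⟩ : ∃ σ : ℝ, σ * z (N + 1) x = z (N + 1) x ∧
        -σ * z N x = z N x + 2 * (transferCoeff N (a N) x * z (N + 1) x) := by
      rcases hx with hx | hx
      · refine ⟨-1, ?_, ?_⟩ <;> simp [hp, hx]
      · refine ⟨1, by simp, ?_⟩
        have := hz N le_rfl x
        rw [hq, hx] at this
        linarith
    have hdouble : ∀ t : ℝ, transferCoeff N (2 * t) x = 2 * transferCoeff N t x := by
      intro t; unfold transferCoeff; split_ifs <;> ring
    let Z : ℕ → ℝ := fun i =>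
      if i ≤ N + 1 then z i x else σ * (-1) ^ (i + N + 1) * z (2 * N + 2 - i) x
    have hZlow : ∀ i ≤ N + 1, Z i = z i x := fun i hi => if_pos hi
    have hZhigh : ∀ j ≤ N + 1, Z (N + 1 + j) = σ * (-1) ^ j * z (N + 1 - j) x := by
      intro j hj
      rcases Nat.eq_zero_or_pos j with rfl | hj0
      · rw [hZlow _ (by omega)]; simp [hσ1]
      · dsimp only [Z]
        rw [if_neg (by omega), show N + 1 + j + N + 1 = 2 * (N + 1) + j by ring, pow_add, pow_mul,
          show 2 * N + 2 - (N + 1 + j) = N + 1 - j by omega]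
        simp
    refine ⟨Z, ?_, ?_, ?_, ?_⟩
    · rw [hZlow 0 (by omega), hz0]
    · rw [hZlow 1 (by omega), hz1]; exact hγ
    · rw [show 2 * N + 2 = N + 1 + (N + 1) by ring, hZhigh _ le_rfl]
      simp [hz0]
    · intro i hi
      rcases lt_trichotomy i N with h | rfl | h
      · rw [hZlow _ (by omega), hZlow _ (by omega), hZlow _ (by omega), hz i h.le x]
        simp [A, h]
      · rw [show i + 2 = i + 1 + 1 by ring, hZhigh 1 (by omega), hZlow _ (by omega),
          hZlow _ (by omega)]
        simp only [A, lt_irrefl, if_false, if_true, hdouble, Nat.add_sub_cancel]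
        linarith
      · obtain ⟨j, rfl⟩ : ∃ j, i = N + 1 + j := ⟨i - (N + 1), by omega⟩
        obtain ⟨k, rfl⟩ : ∃ k, N = j + 1 + k := ⟨N - (j + 1), by omega⟩
        rw [show j + 1 + k + 1 + j + 2 = j + 1 + k + 1 + (j + 2) by ring, hZhigh _ (by omega),
          hZhigh _ (by omega), show j + 1 + k + 1 + j + 1 = j + 1 + k + 1 + (j + 1) by ring,
          hZhigh _ (by omega), show j + 1 + k + 1 - (j + 2) = k by omega,
          show j + 1 + k + 1 - (j + 1) = k + 1 by omega,
          show j + 1 + k + 1 - j = k + 2 by omega, hz k (by omega) x]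
        have hA : A (j + 1 + k + 1 + j) = a k := by
          dsimp only [A]
          rw [if_neg (by omega), if_neg (by omega)]
          congr 1; omega
        have hcoeff : transferCoeff (j + 1 + k + 1 + j) (a k) x = transferCoeff k (a k) x := by
          unfold transferCoeff
          rw [show j + 1 + k + 1 + j = k + 2 * (j + 1) by ring]
          simp [Nat.even_add]
        rw [hA, hcoeff]
        ring

lemma stiffness_mulVec (N : ℕ) (κ U : ℕ → ℝ) (hU0 : U 0 = 0) (hUN : U (N + 1) = 0) (i : Fin N) :
    (stiffness N (fun j => κ j) *ᵥ fun j => U (j + 1)) i =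
      κ i * (U (i + 1) - U i) - κ (i + 1) * (U (i + 2) - U (i + 1)) := by
  obtain ⟨i, hi⟩ := i
  have hsplit : ∀ j : Fin N, stiffness N (fun j => κ j) ⟨i, hi⟩ j * U (j + 1) =
      (if i = (j : ℕ) then (κ i + κ (i + 1)) * U (i + 1) else 0) +
      (if i + 1 = (j : ℕ) then -(κ (i + 1) * U (i + 2)) else 0) +
      (if (j : ℕ) + 1 = i then -(κ i * U i) else 0) := by
    rintro ⟨j, hj⟩
    simp only [stiffness, Matrix.of_apply, Fin.mk.injEq, Fin.val_castSucc, Fin.val_succ]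
    rcases lt_trichotomy i j with h | rfl | h
    · by_cases h1 : i + 1 = j
      · subst h1; simp [show i + 1 + 1 ≠ i by omega]
      · simp [h.ne, h1, show j + 1 ≠ i by omega]
    · simp
    · by_cases h1 : j + 1 = i
      · subst h1; simp [show j + 1 + 1 ≠ j by omega]
      · simp [h.ne', h1, show i + 1 ≠ j by omega]
  simp only [Matrix.mulVec, dotProduct]
  rw [Finset.sum_congr rfl fun j _ => hsplit j, Finset.sum_add_distrib, Finset.sum_add_distrib,
    Fin.sum_univ_eq_sum_range
      (fun j => if i = j then (κ i + κ (i + 1)) * U (i + 1) else 0) N,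
    Fin.sum_univ_eq_sum_range (fun j => if i + 1 = j then -(κ (i + 1) * U (i + 2)) else 0) N,
    Fin.sum_univ_eq_sum_range (fun j => if j + 1 = i then -(κ i * U i) else 0) N,
    Finset.sum_ite_eq, Finset.sum_ite_eq, if_pos (Finset.mem_range.2 hi)]
  have h2 : (if i + 1 ∈ Finset.range N then -(κ (i + 1) * U (i + 2)) else 0) =
      -(κ (i + 1) * U (i + 2)) := by
    split_ifs with h
    · rfl
    · rw [Finset.mem_range] at h
      rw [show i + 2 = N + 1 by omega, hUN]; simp
  have h3 : ∑ j ∈ Finset.range N, (if j + 1 = i then -(κ i * U i) else 0) = -(κ i * U i) := by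
    cases i with
    | zero => simp [hU0]
    | succ i => simp [show i < N by omega]
  rw [h2, h3]
  ring

/-- A nonzero solution of `K u = x M u` makes `x` a root of the characteristic polynomial
of `D⁻¹ K D⁻¹`. -/
lemma normStiff_charpoly_isRoot {N : ℕ} {ms : Fin N → ℝ} {ks : Fin (N + 1) → ℝ}
    (hms : ∀ i, 0 < ms i) {x : ℝ} {u : Fin N → ℝ} (hu : u ≠ 0)
    (h : ∀ i, (stiffness N ks *ᵥ u) i = x * (ms i * u i)) :
    (normStiff N ms ks).charpoly.IsRoot x := by
  have hs : ∀ i, 0 < Real.sqrt (ms i) := fun i => Real.sqrt_pos.2 (hms i)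
  rw [IsRoot.def, Matrix.eval_charpoly, ← Matrix.exists_mulVec_eq_zero_iff]
  refine ⟨fun i => Real.sqrt (ms i) * u i, ?_, ?_⟩
  · intro h0
    refine hu (funext fun i => ?_)
    simpa [(hs i).ne'] using congrFun h0 i
  · have hD : (Matrix.diagonal fun i => (Real.sqrt (ms i))⁻¹) *ᵥ
        (fun i => Real.sqrt (ms i) * u i) = u := by
      funext i
      rw [Matrix.mulVec_diagonal, inv_mul_cancel_left₀ (hs i).ne']
    funext i
    rw [Matrix.sub_mulVec, normStiff, ← Matrix.mulVec_mulVec, ← Matrix.mulVec_mulVec, hD,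
      Pi.sub_apply, Matrix.mulVec_diagonal, h]
    simp only [Matrix.scalar_apply, Matrix.mulVec_diagonal, Pi.zero_apply]
    have := (hs i).ne'
    field_simp
    rw [Real.sq_sqrt (hms i).le]
    ring

lemma charpoly_eq_prod_of_isRoot {N : ℕ} (T : Matrix (Fin N) (Fin N) ℝ) {lam : Fin N → ℝ}
    (hinj : Function.Injective lam) (h : ∀ j, T.charpoly.IsRoot (lam j)) :
    T.charpoly = ∏ j, (X - C (lam j)) := by
  refine (eq_of_monic_of_dvd_of_natDegree_le
    (monic_prod_of_monic _ _ fun i _ => monic_X_sub_C _) T.charpoly_monic ?_ ?_)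
  · exact Finset.prod_dvd_of_coprime ((pairwise_coprime_X_sub_C hinj).set_pairwise _)
      fun j _ => dvd_iff_isRoot.2 (h j)
  · rw [T.charpoly_natDegree_eq_dim]; simp

/-- Existence part of the reconstruction theorem: for any prescribed
eigenvalues `0 < λ₁ < ⋯ < λ_N` and total mass `m > 0`, there is a
persymmetric mass–spring system with total mass `m` whose proper
oscillation modes (the eigenvalues of `D⁻¹ K D⁻¹`) are exactly the `λⱼ`. -/
theorem reconstruction_existence (N : ℕ) (hN : 1 ≤ N)
    (lam : Fin N → ℝ) (hlam0 : ∀ j, 0 < lam j) (hmono : StrictMono lam)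
    (m : ℝ) (hm : 0 < m) :
    ∃ (ms : Fin N → ℝ) (ks : Fin (N + 1) → ℝ),
      (∀ i, 0 < ms i) ∧ (∀ i, 0 < ks i) ∧
      (∑ i, ms i) = m ∧
      (∀ i : Fin N, ms i = ms i.rev) ∧
      (∀ i : Fin (N + 1), ks i = ks i.rev) ∧
      (normStiff N ms ks).charpoly = ∏ j, (X - C (lam j)) := by
  let l : ℕ → ℝ := fun i => if h : i < N then lam ⟨i, h⟩ else 0
  have hl : ∀ j : Fin N, l j = lam j := fun j => dif_pos j.2
  obtain ⟨p, q, hpq, hroot⟩ := exists_isTransferPair N l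
    (fun i hi => by rw [hl ⟨i, hi⟩]; exact hlam0 _)
    (fun i j hij hj => by rw [hl ⟨i, hij.trans hj⟩, hl ⟨j, hj⟩]; exact hmono hij)
  obtain ⟨A, hA, hsymm, hwave⟩ := hpq.exists_palindrome
  have hS : 0 < ∑ i : Fin N, A (2 * i + 1) :=
    Finset.sum_pos (fun i _ => hA _) ⟨⟨0, hN⟩, Finset.mem_univ _⟩
  set t : ℝ := m / ∑ i : Fin N, A (2 * i + 1) with ht
  have ht0 : 0 < t := div_pos hm hS
  have hms : ∀ i : Fin N, 0 < t * A (2 * i + 1) := fun i => mul_pos ht0 (hA _)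
  refine ⟨fun i => t * A (2 * i + 1), fun i => t / A (2 * i), hms, fun i => div_pos ht0 (hA _),
    ?_, fun i => ?_, fun i => ?_, ?_⟩
  · rw [← Finset.mul_sum, ht, div_mul_cancel₀ _ hS.ne']
  · dsimp only
    rw [← hsymm (2 * i + 1) (by omega), Fin.val_rev]
    congr 2; omega
  · dsimp only
    rw [← hsymm (2 * i) (by omega), Fin.val_rev]
    congr 2; omega
  · refine charpoly_eq_prod_of_isRoot _ hmono.injective fun j => ?_
    obtain ⟨Z, hZ0, hZ1, hZN, hZ⟩ := hwave (lam j) (by rw [← hl j]; exact hroot j j.2)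
    have hspring : ∀ i ≤ N, Z (2 * (i + 1)) - Z (2 * i) = A (2 * i) * Z (2 * i + 1) := by
      intro i hi
      have := hZ (2 * i) (by omega)
      rw [transferCoeff, if_pos (even_two_mul i)] at this
      rw [show 2 * (i + 1) = 2 * i + 2 by ring]
      linarith
    refine normStiff_charpoly_isRoot hms (u := fun i => Z (2 * (i + 1))) ?_ fun i => ?_
    · intro h0
      have h1 : Z 2 = 0 := congrFun h0 ⟨0, hN⟩
      have h2 := hspring 0 (by omega)
      simp only [mul_zero, zero_add, mul_one, h1, hZ0, sub_zero] at h2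
      exact (mul_pos (hA 0) hZ1).ne h2
    · rw [stiffness_mulVec N (fun i => t / A (2 * i)) (fun i => Z (2 * i)) hZ0 hZN i,
        hspring i (by omega), hspring (i + 1) (by omega)]
      have hmass := hZ (2 * i + 1) (by omega)
      rw [transferCoeff, if_neg (by simp), show 2 * (i : ℕ) + 1 + 2 = 2 * (i + 1) + 1 by ring,
        show 2 * (i : ℕ) + 1 + 1 = 2 * (i + 1) by ring] at hmass
      have hA1 := (hA (2 * i)).ne'
      have hA2 := (hA (2 * (i + 1))).ne'
      rw [hmass]
      field_simp
      ring
end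

section
/- Let N ≥ 1, let 0 < λ₁ < λ₂ < ⋯ < λ_N be real numbers, and let m > 0. Suppose (m₁,…,m_N, k₁,…,k_{N+1}) and (m′₁,…,m′_N, k′₁,…,k′_{N+1}) are two persymmetric mass–spring systems with positive masses and positive spring constants, both with total mass m₁ + ⋯ + m_N = m′₁ + ⋯ + m′_N = m, and such that for both systems the eigenvalues of D⁻¹ K D⁻¹ (respectively D′⁻¹ K′ D′⁻¹) are exactly λ₁,…,λ_N. Then m_i = m′_i for all 1 ≤ i ≤ N and k_i = k′_i for all 1 ≤ i ≤ N+1. -/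
open Matrix Polynomial

/-- A real Jacobi matrix with negative off-diagonal entries. -/
structure IsNegJacobi {N : ℕ} (J : Matrix (Fin N) (Fin N) ℝ) : Prop where
  isSymm : J.IsSymm
  eq_zero : ∀ i j : Fin N, (i : ℕ) + 1 < j → J i j = 0
  neg : ∀ i j : Fin N, (i : ℕ) + 1 = j → J i j < 0

theorem Matrix.IsSymm.aeval {ι R : Type*} [Fintype ι] [DecidableEq ι] [CommRing R]
    {A : Matrix ι ι R} (hA : A.IsSymm) (p : R[X]) : (Polynomial.aeval A p).IsSymm := by
  induction p using Polynomial.induction_on' with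
  | add p q hp hq => simpa using hp.add hq
  | monomial k a =>
    rw [Polynomial.aeval_monomial, ← Algebra.smul_def]
    exact (hA.pow k).smul a

theorem Matrix.aeval_mul_apply_of_isSymm {ι R : Type*} [Fintype ι] [DecidableEq ι] [CommRing R]
    {A : Matrix ι ι R} (hA : A.IsSymm) (p q : R[X]) (i j : ι) :
    Polynomial.aeval A (p * q) i j =
      ∑ l, Polynomial.aeval A p l i * Polynomial.aeval A q l j := by
  rw [map_mul, Matrix.mul_apply]
  exact Finset.sum_congr rfl fun l _ => by rw [(hA.aeval p).apply]

/-- A polynomial vanishing at all the (distinct) eigenvalues of a matrix annihilates it. -/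
theorem Matrix.aeval_eq_zero_of_eval_eq_zero {ι κ K : Type*} [Fintype ι] [DecidableEq ι]
    [Fintype κ] [Field K] {A : Matrix ι ι K} {lam : κ → K} (hlam : Function.Injective lam)
    (hA : A.charpoly = ∏ j, (X - C (lam j))) {p : K[X]} (hp : ∀ j, p.eval (lam j) = 0) :
    Polynomial.aeval A p = 0 := by
  have hdvd : A.charpoly ∣ p := by
    rw [hA]
    exact Finset.prod_dvd_of_coprime
      (fun i _ j _ hij => Polynomial.pairwise_coprime_X_sub_C hlam hij)
      fun j _ => Polynomial.dvd_iff_isRoot.2 (hp j)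
  obtain ⟨q, rfl⟩ := hdvd
  rw [map_mul, Matrix.aeval_self_charpoly, zero_mul]

theorem Lagrange.eval_basis_univ {κ K : Type*} [Fintype κ] [DecidableEq κ] [Field K]
    {lam : κ → K} (hlam : Function.Injective lam) (i j : κ) :
    (Lagrange.basis Finset.univ lam i).eval (lam j) = if i = j then 1 else 0 := by
  split_ifs with h
  · subst h
    exact Lagrange.eval_basis_self hlam.injOn (Finset.mem_univ i)
  · exact Lagrange.eval_basis_of_ne h (Finset.mem_univ j)

/-- The spectral decomposition of a matrix polynomial in terms of the spectral projections. -/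
theorem Matrix.aeval_eq_sum_basis {ι κ K : Type*} [Fintype ι] [DecidableEq ι]
    [Fintype κ] [DecidableEq κ] [Field K] {A : Matrix ι ι K} {lam : κ → K}
    (hlam : Function.Injective lam) (hA : A.charpoly = ∏ j, (X - C (lam j))) (p : K[X]) :
    Polynomial.aeval A p =
      ∑ j, p.eval (lam j) • Polynomial.aeval A (Lagrange.basis Finset.univ lam j) := by
  have h : Polynomial.aeval A
      (p - ∑ j, C (p.eval (lam j)) * Lagrange.basis Finset.univ lam j) = 0 := by
    refine Matrix.aeval_eq_zero_of_eval_eq_zero hlam hA fun i => ?_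
    simp [Polynomial.eval_finsetSum, Lagrange.eval_basis_univ hlam]
  rw [map_sub, sub_eq_zero] at h
  rw [h, map_sum]
  exact Finset.sum_congr rfl fun j _ => by
    rw [map_mul, Polynomial.aeval_C, Algebra.smul_def]

namespace IsNegJacobi

variable {n : ℕ} {J J' : Matrix (Fin (n + 1)) (Fin (n + 1)) ℝ}

theorem eq_zero_of_lt {N : ℕ} {J : Matrix (Fin N) (Fin N) ℝ} (hJ : IsNegJacobi J)
    {i j : Fin N} (h : (j : ℕ) + 1 < i) : J i j = 0 := by
  rw [hJ.isSymm.apply]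
  exact hJ.eq_zero j i h

/-- An eigenvector of a Jacobi matrix is determined by its first component. -/
theorem eq_zero_of_mulVec_eq (hJ : IsNegJacobi J) {t : ℝ} {v : Fin (n + 1) → ℝ}
    (hv : J *ᵥ v = t • v) (h0 : v 0 = 0) : v = 0 := by
  have key : ∀ k : ℕ, ∀ i : Fin (n + 1), (i : ℕ) = k → v i = 0 := by
    intro k
    induction k using Nat.strong_induction_on with
    | _ k ih =>
      intro i hi
      rcases Fin.eq_zero_or_eq_succ i with rfl | ⟨j, rfl⟩
      · exact h0
      have hj : v j.castSucc = 0 := ih j (by simp at hi; omega) _ (by simp)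
      have hrow := congrFun hv j.castSucc
      rw [Pi.smul_apply, hj, smul_zero, Matrix.mulVec, dotProduct,
        Finset.sum_eq_single j.succ] at hrow
      · exact (mul_eq_zero.1 hrow).resolve_left (hJ.neg _ _ (by simp)).ne
      · intro l _ hl
        rcases lt_or_gt_of_ne hl with h | h
        · rw [ih l (by rw [← hi]; exact h) l rfl, mul_zero]
        · rw [hJ.eq_zero _ _ (by simpa [Fin.lt_def] using h), zero_mul]
      · simp
  exact funext fun i => key i i rfl

theorem pow_apply_zero_eq_zero (hJ : IsNegJacobi J) {k : ℕ} {i : Fin (n + 1)}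
    (h : k < (i : ℕ)) : (J ^ k) i 0 = 0 := by
  induction k generalizing i with
  | zero => simpa using Matrix.one_apply_ne (Fin.pos_iff_ne_zero.1 h)
  | succ k ih =>
    rw [pow_succ', Matrix.mul_apply]
    refine Finset.sum_eq_zero fun l _ => ?_
    rcases lt_or_ge k (l : ℕ) with hl | hl
    · rw [ih hl, mul_zero]
    · rw [hJ.eq_zero_of_lt (by omega), zero_mul]

/-- The corner entry of a polynomial of degree at most `n` in a Jacobi matrix only sees the
coefficient of degree `n`. -/
theorem aeval_last_zero (hJ : IsNegJacobi J) {p : ℝ[X]} (hp : p.natDegree < n + 1) :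
    Polynomial.aeval J p (Fin.last n) 0 = p.coeff n * (J ^ n) (Fin.last n) 0 := by
  rw [Polynomial.aeval_eq_sum_range' hp, Matrix.sum_apply, Finset.sum_range_succ,
    Finset.sum_eq_zero, zero_add, Matrix.smul_apply, smul_eq_mul]
  intro k hk
  rw [Matrix.smul_apply, hJ.pow_apply_zero_eq_zero (by simpa using hk), smul_zero]

/-- The spectral weights of a persymmetric Jacobi matrix, up to a common factor, depend only
on the eigenvalues. -/
theorem aeval_basis_zero_zero (hJ : IsNegJacobi J) (hper : ∀ i j, J i.rev j.rev = J i j)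
    {lam : Fin (n + 1) → ℝ} (hlam : Function.Injective lam)
    (hchar : J.charpoly = ∏ j, (X - C (lam j))) (j : Fin (n + 1)) :
    Polynomial.aeval J (Lagrange.basis Finset.univ lam j) 0 0 =
      |(Lagrange.basis Finset.univ lam j).coeff n| * |(J ^ n) (Fin.last n) 0| := by
  set p := Lagrange.basis Finset.univ lam j with hp
  have hdeg : p.natDegree < n + 1 := by
    have := Lagrange.degree_basis (s := Finset.univ) hlam.injOn (Finset.mem_univ j)
    rw [← hp] at this
    have := Polynomial.natDegree_eq_of_degree_eq_some this
    simp at this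
    omega
  have hidem : Polynomial.aeval J p = Polynomial.aeval J (p * p) := by
    rw [← sub_eq_zero, ← map_sub]
    refine Matrix.aeval_eq_zero_of_eval_eq_zero hlam hchar fun i => ?_
    by_cases h : j = i <;> simp [hp, Lagrange.eval_basis_univ hlam, h]
  have hnonneg : 0 ≤ Polynomial.aeval J p 0 0 := by
    rw [hidem, Matrix.aeval_mul_apply_of_isSymm hJ.isSymm]
    exact Finset.sum_nonneg fun _ _ => mul_self_nonneg _
  have heig : J * Polynomial.aeval J p = lam j • Polynomial.aeval J p := by
    have h : Polynomial.aeval J ((X - C (lam j)) * p) = 0 := by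
      refine Matrix.aeval_eq_zero_of_eval_eq_zero hlam hchar fun i => ?_
      by_cases h : j = i <;> simp [hp, Lagrange.eval_basis_univ hlam, h]
    rw [map_mul, map_sub, Polynomial.aeval_X, Polynomial.aeval_C, sub_mul, sub_eq_zero] at h
    rw [h, Algebra.smul_def]
  set v : Fin (n + 1) → ℝ := fun i => Polynomial.aeval J p i 0 with hv
  have hv1 : ∀ i, ∑ l, J i l * v l = lam j * v i := fun i => by
    have := congrFun (congrFun heig i) 0
    rwa [Matrix.mul_apply] at this
  have hv2 : ∀ i, ∑ l, J i l * v l.rev = lam j * v i.rev := fun i => by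
    rw [← hv1, ← Equiv.sum_comp Fin.revPerm]
    refine Finset.sum_congr rfl fun l _ => ?_
    rw [← hper i]
    simp
  have hw : (fun i => v 0 * v i.rev - v (Fin.last n) * v i) = 0 := by
    refine hJ.eq_zero_of_mulVec_eq (t := lam j) (funext fun i => ?_) (by simp; ring)
    simp only [Matrix.mulVec, dotProduct, Pi.smul_apply, smul_eq_mul]
    calc ∑ l, J i l * (v 0 * v l.rev - v (Fin.last n) * v l)
        = v 0 * ∑ l, J i l * v l.rev - v (Fin.last n) * ∑ l, J i l * v l := by
          rw [Finset.mul_sum, Finset.mul_sum, ← Finset.sum_sub_distrib]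
          exact Finset.sum_congr rfl fun l _ => by ring
      _ = lam j * (v 0 * v i.rev - v (Fin.last n) * v i) := by rw [hv1, hv2]; ring
  have hsq : |v 0| = |v (Fin.last n)| := by
    have := congrFun hw (Fin.last n)
    simp only [Fin.rev_last, Pi.zero_apply] at this
    exact abs_eq_abs.2 (mul_self_eq_mul_self_iff.1 (sub_eq_zero.1 this))
  rw [← abs_of_nonneg hnonneg, ← abs_mul, ← hJ.aeval_last_zero hdeg]
  exact hsq

/-- A Jacobi matrix is determined by its moments at the first basis vector. -/
theorem eq_of_aeval_zero_zero_eq (hJ : IsNegJacobi J) (hJ' : IsNegJacobi J')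
    (h : ∀ p : ℝ[X], Polynomial.aeval J p 0 0 = Polynomial.aeval J' p 0 0) : J = J' := by
  have entry : ∀ {A : Matrix (Fin (n + 1)) (Fin (n + 1)) ℝ}, IsNegJacobi A →
      ∀ {p q : ℝ[X]} {i k : Fin (n + 1)},
      (∀ l, Polynomial.aeval A p l 0 = if l = i then 1 else 0) →
      (∀ l, Polynomial.aeval A q l 0 = if l = k then 1 else 0) →
      Polynomial.aeval A (p * (X * q)) 0 0 = A i k := by
    intro A hA p q i k hp hq
    rw [Matrix.aeval_mul_apply_of_isSymm hA.isSymm]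
    simp [hp, hq, Matrix.mul_apply]
  have key : ∀ k : ℕ, ∀ i : Fin (n + 1), (i : ℕ) = k → ∃ p : ℝ[X],
      (∀ l, Polynomial.aeval J p l 0 = if l = i then 1 else 0) ∧
      (∀ l, Polynomial.aeval J' p l 0 = if l = i then 1 else 0) := by
    intro k
    induction k using Nat.strong_induction_on with
    | _ k ih =>
      intro i hi
      rcases Fin.eq_zero_or_eq_succ i with rfl | ⟨j, rfl⟩
      · exact ⟨1, fun l => by simp [Matrix.one_apply], fun l => by simp [Matrix.one_apply]⟩
      have ih' : ∀ l : Fin (n + 1), ∃ p : ℝ[X], l < j.succ →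
          (∀ a, Polynomial.aeval J p a 0 = if a = l then 1 else 0) ∧
          (∀ a, Polynomial.aeval J' p a 0 = if a = l then 1 else 0) := by
        intro l
        by_cases hl : l < j.succ
        · obtain ⟨p, hp⟩ := ih l (by rw [← hi]; exact hl) l rfl
          exact ⟨p, fun _ => hp⟩
        · exact ⟨0, fun h => absurd h hl⟩
      choose P hP using ih'
      have hj : j.castSucc < j.succ := by simp [Fin.lt_def]
      have hJJ : ∀ l < j.succ, J l j.castSucc = J' l j.castSucc := fun l hl => by
        rw [← entry hJ (hP l hl).1 (hP _ hj).1, ← entry hJ' (hP l hl).2 (hP _ hj).2, h]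
      set q : ℝ[X] := X * P j.castSucc -
        ∑ l ∈ Finset.univ.filter (· < j.succ), C (J l j.castSucc) * P l with hq
      have hqA : ∀ {A : Matrix (Fin (n + 1)) (Fin (n + 1)) ℝ}, IsNegJacobi A →
          (∀ l < j.succ, J l j.castSucc = A l j.castSucc) →
          (∀ l < j.succ, ∀ a, Polynomial.aeval A (P l) a 0 = if a = l then 1 else 0) →
          ∀ a, Polynomial.aeval A q a 0 = if a = j.succ then A j.succ j.castSucc else 0 := by
        intro A hA hJA hPA a
        have hsum : Polynomial.aeval A q a 0 = A a j.castSucc -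
            ∑ l ∈ Finset.univ.filter (· < j.succ), if a = l then A l j.castSucc else 0 := by
          rw [hq, map_sub, map_sum, Matrix.sub_apply, Matrix.sum_apply, map_mul,
            Polynomial.aeval_X, Matrix.mul_apply]
          congr 1
          · simp [hPA _ hj]
          · refine Finset.sum_congr rfl fun l hl => ?_
            have hl : l < j.succ := by simpa using hl
            rw [map_mul, Polynomial.aeval_C, ← Algebra.smul_def, Matrix.smul_apply,
              hPA l hl, hJA l hl]
            simp
        rw [hsum, Finset.sum_ite_eq]
        rcases lt_trichotomy a j.succ with ha | rfl | ha
        · simp [ha, ha.ne]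
        · simp
        · rw [hA.eq_zero_of_lt (by simpa [Fin.lt_def] using ha)]
          simp [ha.ne', not_lt.2 ha.le]
      have hqJ := hqA hJ (fun _ _ => rfl) fun l hl => (hP l hl).1
      have hqJ' := hqA hJ' hJJ fun l hl => (hP l hl).2
      have hsq := h (q * q)
      rw [Matrix.aeval_mul_apply_of_isSymm hJ.isSymm,
        Matrix.aeval_mul_apply_of_isSymm hJ'.isSymm] at hsq
      simp only [hqJ, hqJ', mul_ite, ite_mul, zero_mul, mul_zero, Finset.sum_ite_eq',
        Finset.mem_univ, if_true] at hsq
      have hneg : J j.succ j.castSucc < 0 := by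
        rw [hJ.isSymm.apply]; exact hJ.neg _ _ (by simp)
      have hneg' : J' j.succ j.castSucc < 0 := by
        rw [hJ'.isSymm.apply]; exact hJ'.neg _ _ (by simp)
      have hb : J j.succ j.castSucc = J' j.succ j.castSucc := by
        rcases mul_self_eq_mul_self_iff.1 hsq with h | h <;> linarith
      refine ⟨C (J j.succ j.castSucc)⁻¹ * q, fun l => ?_, fun l => ?_⟩ <;>
        rw [map_mul, Polynomial.aeval_C, ← Algebra.smul_def, Matrix.smul_apply]
      · rw [hqJ]; split_ifs <;> simp [hneg.ne]
      · rw [hqJ', hb]; split_ifs <;> simp [hneg'.ne]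
  ext i k
  obtain ⟨p, hp, hp'⟩ := key i i rfl
  obtain ⟨q, hq, hq'⟩ := key k k rfl
  rw [← entry hJ hp hq, ← entry hJ' hp' hq', h]

/-- **Hochstadt's theorem**: a persymmetric Jacobi matrix is determined by its spectrum. -/
theorem eq_of_charpoly_eq (hJ : IsNegJacobi J) (hJ' : IsNegJacobi J')
    (hper : ∀ i j, J i.rev j.rev = J i j) (hper' : ∀ i j, J' i.rev j.rev = J' i j)
    {lam : Fin (n + 1) → ℝ} (hlam : Function.Injective lam)
    (hchar : J.charpoly = ∏ j, (X - C (lam j)))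
    (hchar' : J'.charpoly = ∏ j, (X - C (lam j))) : J = J' := by
  set c : Fin (n + 1) → ℝ := fun j => |(Lagrange.basis Finset.univ lam j).coeff n| with hc
  have expand : ∀ {A : Matrix (Fin (n + 1)) (Fin (n + 1)) ℝ}, IsNegJacobi A →
      (∀ i j, A i.rev j.rev = A i j) → A.charpoly = ∏ j, (X - C (lam j)) → ∀ p : ℝ[X],
      Polynomial.aeval A p 0 0 = (∑ j, p.eval (lam j) * c j) * |(A ^ n) (Fin.last n) 0| := by
    intro A hA hAper hAchar p
    rw [Matrix.aeval_eq_sum_basis hlam hAchar, Matrix.sum_apply, Finset.sum_mul]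
    refine Finset.sum_congr rfl fun j _ => ?_
    rw [Matrix.smul_apply, hA.aeval_basis_zero_zero hAper hlam hAchar, smul_eq_mul, mul_assoc]
  have h1 := expand hJ hper hchar 1
  have h1' := expand hJ' hper' hchar' 1
  simp only [map_one, Matrix.one_apply_eq, Polynomial.eval_one, one_mul] at h1 h1'
  have hβ : |(J ^ n) (Fin.last n) 0| = |(J' ^ n) (Fin.last n) 0| :=
    mul_left_cancel₀ (left_ne_zero_of_mul_eq_one h1.symm) (h1.symm.trans h1')
  refine hJ.eq_of_aeval_zero_zero_eq hJ' fun p => ?_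
  rw [expand hJ hper hchar, expand hJ' hper' hchar', hβ]

end IsNegJacobi

theorem normStiff_apply {N : ℕ} (ms : Fin N → ℝ) (ks : Fin (N + 1) → ℝ) (i j : Fin N) :
    normStiff N ms ks i j = (Real.sqrt (ms i))⁻¹ * stiffness N ks i j * (Real.sqrt (ms j))⁻¹ := by
  simp [normStiff, Matrix.mul_diagonal, Matrix.diagonal_mul]

theorem stiffness_isSymm {N : ℕ} (ks : Fin (N + 1) → ℝ) : (stiffness N ks).IsSymm := by
  refine Matrix.IsSymm.ext fun i j => ?_
  simp only [stiffness, Matrix.of_apply]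
  grind

theorem stiffness_rev {N : ℕ} {ks : Fin (N + 1) → ℝ} (hk : ∀ i, ks i = ks i.rev) (i j : Fin N) :
    stiffness N ks i.rev j.rev = stiffness N ks i j := by
  have hcast : ∀ l : Fin N, ks l.rev.castSucc = ks l.succ := fun l => by
    rw [hk l.succ, Fin.rev_succ]
  have hsucc : ∀ l : Fin N, ks l.rev.succ = ks l.castSucc := fun l => by
    rw [hk l.castSucc, Fin.rev_castSucc]
  have hadj : ∀ a b : Fin N, (a : ℕ) + 1 = b → ks a.succ = ks b.castSucc := fun a b h =>
    congrArg ks (Fin.ext (by simpa using h))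
  have hi := Fin.val_rev i
  have hj := Fin.val_rev j
  simp only [stiffness, Matrix.of_apply, hcast, hsucc, Fin.rev_inj, hi, hj]
  have h1 : (N - ((i : ℕ) + 1) + 1 = N - ((j : ℕ) + 1)) ↔ (j : ℕ) + 1 = i := by omega
  have h2 : (N - ((j : ℕ) + 1) + 1 = N - ((i : ℕ) + 1)) ↔ (i : ℕ) + 1 = j := by omega
  simp only [h1, h2]
  split_ifs with h3 h4 h5 h6
  · ring
  · omega
  · rw [hadj j i h4]
  · rw [hadj i j h6]
  · rfl

theorem normStiff_isNegJacobi {N : ℕ} {ms : Fin N → ℝ} {ks : Fin (N + 1) → ℝ}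
    (hms : ∀ i, 0 < ms i) (hks : ∀ i, 0 < ks i) : IsNegJacobi (normStiff N ms ks) where
  isSymm := Matrix.IsSymm.ext fun i j => by
    rw [normStiff_apply, normStiff_apply, (stiffness_isSymm ks).apply]
    ring
  eq_zero i j h := by
    have : stiffness N ks i j = 0 := by
      simp only [stiffness, Matrix.of_apply]
      grind
    rw [normStiff_apply, this, mul_zero, zero_mul]
  neg i j h := by
    have : stiffness N ks i j = -ks j.castSucc := by
      simp only [stiffness, Matrix.of_apply]
      grind
    rw [normStiff_apply, this]
    have hi := inv_pos.2 (Real.sqrt_pos.2 (hms i))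
    have hj := inv_pos.2 (Real.sqrt_pos.2 (hms j))
    exact mul_neg_of_neg_of_pos (mul_neg_of_pos_of_neg hi (neg_neg_of_pos (hks _))) hj

/-- A rigid displacement of the chain is only resisted by the two outer springs. -/
theorem sum_stiffness {n : ℕ} (ks : Fin (n + 2) → ℝ) (i : Fin (n + 1)) :
    ∑ j, stiffness (n + 1) ks i j =
      (if i = 0 then ks 0 else 0) + if i = Fin.last n then ks (Fin.last (n + 1)) else 0 := by
  have hsplit : ∀ j, stiffness (n + 1) ks i j =
      (if i = j then ks i.castSucc + ks i.succ else 0)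
      + (if (i : ℕ) + 1 = j then -ks i.succ else 0)
      + (if (j : ℕ) + 1 = i then -ks i.castSucc else 0) := by
    intro j
    have hadj : (i : ℕ) + 1 = j → ks i.succ = ks j.castSucc := fun h =>
      congrArg ks (Fin.ext (by simpa using h))
    simp only [stiffness, Matrix.of_apply]
    grind
  have hup : ∑ j : Fin (n + 1), (if (i : ℕ) + 1 = j then -ks i.succ else 0) =
      if i = Fin.last n then 0 else -ks i.succ := by
    induction i using Fin.lastCases with
    | last => simp [fun j : Fin (n + 1) => j.isLt.ne']
    | cast i =>
      rw [Finset.sum_eq_single i.succ]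
      · simp [Fin.castSucc_ne_last]
      · intro b _ hb
        exact if_neg fun h => hb (Fin.ext (by simpa using h.symm))
      · simp
  have hdown : ∑ j : Fin (n + 1), (if (j : ℕ) + 1 = i then -ks i.castSucc else 0) =
      if i = 0 then 0 else -ks i.castSucc := by
    induction i using Fin.cases with
    | zero => simp
    | succ i =>
      rw [Finset.sum_eq_single i.castSucc]
      · simp [Fin.succ_ne_zero]
      · intro b _ hb
        exact if_neg fun h => hb (Fin.ext (by simpa using h))
      · simp
  simp only [hsplit, Finset.sum_add_distrib, hup, hdown, Finset.sum_ite_eq, Finset.mem_univ,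
    if_true]
  split_ifs with h1 h2 h2
  · have hcast : i.castSucc = 0 := by rw [h2, Fin.castSucc_zero]
    have hsucc : i.succ = Fin.last (n + 1) := by rw [h1, Fin.succ_last]
    rw [hcast, hsucc, add_zero, add_zero]
  · subst h1; simp
  · subst h2; simp
  · ring

theorem normStiff_mulVec_sqrt {n : ℕ} {ms : Fin (n + 1) → ℝ} {ks : Fin (n + 2) → ℝ}
    (hms : ∀ i, 0 < ms i) (hm : ∀ i, ms i = ms i.rev) (hk : ∀ i, ks i = ks i.rev) :
    (normStiff (n + 1) ms ks *ᵥ fun i => Real.sqrt (ms i)) =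
      (ks 0 / Real.sqrt (ms 0)) •
        fun i => (if i = 0 then (1 : ℝ) else 0) + if i = Fin.last n then 1 else 0 := by
  funext i
  have hlast : ms (Fin.last n) = ms 0 := by rw [hm, Fin.rev_last]
  have hklast : ks (Fin.last (n + 1)) = ks 0 := by rw [hk, Fin.rev_last]
  have hrow : (normStiff (n + 1) ms ks *ᵥ fun i => Real.sqrt (ms i)) i =
      (Real.sqrt (ms i))⁻¹ * ∑ j, stiffness (n + 1) ks i j := by
    rw [Matrix.mulVec, dotProduct, Finset.mul_sum]
    refine Finset.sum_congr rfl fun j _ => ?_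
    have := (Real.sqrt_pos.2 (hms j)).ne'
    rw [normStiff_apply]
    field_simp
  rw [hrow, sum_stiffness, hklast, Pi.smul_apply, smul_eq_mul, mul_add, mul_add]
  congr 1
  · split_ifs with h
    · rw [h]; ring
    · simp
  · split_ifs with h
    · rw [h, hlast]; ring
    · simp

/-- Uniqueness part of the reconstruction theorem: two persymmetric
mass–spring systems with positive masses and springs, the same total mass
`m`, and the same prescribed spectrum `0 < λ₁ < ⋯ < λ_N` for `D⁻¹ K D⁻¹`
must coincide. -/
theorem reconstruction_uniqueness (N : ℕ) (hN : 1 ≤ N)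
    (lam : Fin N → ℝ) (hlam0 : ∀ j, 0 < lam j) (hmono : StrictMono lam)
    (m : ℝ) (hm : 0 < m)
    (ms ms' : Fin N → ℝ) (ks ks' : Fin (N + 1) → ℝ)
    (hms : ∀ i, 0 < ms i) (hms' : ∀ i, 0 < ms' i)
    (hks : ∀ i, 0 < ks i) (hks' : ∀ i, 0 < ks' i)
    (htot : (∑ i, ms i) = m) (htot' : (∑ i, ms' i) = m)
    (hper_m : ∀ i : Fin N, ms i = ms i.rev)
    (hper_k : ∀ i : Fin (N + 1), ks i = ks i.rev)
    (hper_m' : ∀ i : Fin N, ms' i = ms' i.rev)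
    (hper_k' : ∀ i : Fin (N + 1), ks' i = ks' i.rev)
    (hspec : (normStiff N ms ks).charpoly = ∏ j, (X - C (lam j)))
    (hspec' : (normStiff N ms' ks').charpoly = ∏ j, (X - C (lam j))) :
    (∀ i, ms i = ms' i) ∧ (∀ i, ks i = ks' i) := by
  obtain ⟨n, rfl⟩ : ∃ n, N = n + 1 := ⟨N - 1, by omega⟩
  have hper : ∀ {μ : Fin (n + 1) → ℝ} {κ : Fin (n + 2) → ℝ}, (∀ i, μ i = μ i.rev) →
      (∀ i, κ i = κ i.rev) → ∀ i j,
      normStiff (n + 1) μ κ i.rev j.rev = normStiff (n + 1) μ κ i j := by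
    intro μ κ hμ hκ i j
    rw [normStiff_apply, normStiff_apply, stiffness_rev hκ, ← hμ, ← hμ]
  have hJ : normStiff (n + 1) ms ks = normStiff (n + 1) ms' ks' :=
    (normStiff_isNegJacobi hms hks).eq_of_charpoly_eq (normStiff_isNegJacobi hms' hks')
      (hper hper_m hper_k) (hper hper_m' hper_k') hmono.injective hspec hspec'
  have hdet : (normStiff (n + 1) ms ks).det ≠ 0 := by
    rw [Matrix.det_eq_sign_charpoly_coeff, hspec, Polynomial.coeff_zero_eq_eval_zero,
      Polynomial.eval_prod]
    refine mul_ne_zero (pow_ne_zero _ (by norm_num)) (Finset.prod_ne_zero_iff.2 fun j _ => ?_)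
    simpa using (hlam0 j).ne'
  set c := ks 0 / Real.sqrt (ms 0) with hc
  set c' := ks' 0 / Real.sqrt (ms' 0) with hc'
  have hcpos : 0 < c := div_pos (hks 0) (Real.sqrt_pos.2 (hms 0))
  have hcpos' : 0 < c' := div_pos (hks' 0) (Real.sqrt_pos.2 (hms' 0))
  have hvec := normStiff_mulVec_sqrt hms hper_m hper_k
  have hvec' := normStiff_mulVec_sqrt hms' hper_m' hper_k'
  rw [← hc] at hvec
  rw [← hc', ← hJ] at hvec'
  have hker : (c' • (fun i => Real.sqrt (ms i)) - c • fun i => Real.sqrt (ms' i)) = 0 := by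
    refine Matrix.eq_zero_of_mulVec_eq_zero hdet ?_
    rw [Matrix.mulVec_sub, Matrix.mulVec_smul, Matrix.mulVec_smul, hvec, hvec', smul_comm,
      sub_self]
  have hprop : ∀ i, c' * Real.sqrt (ms i) = c * Real.sqrt (ms' i) := fun i => by
    simpa [sub_eq_zero] using congrFun hker i
  have hsq : ∀ i, c' ^ 2 * ms i = c ^ 2 * ms' i := fun i => by
    rw [← Real.sq_sqrt (hms i).le, ← Real.sq_sqrt (hms' i).le, ← mul_pow, ← mul_pow, hprop]
  have hcc : c' = c := by
    have h : c' ^ 2 * m = c ^ 2 * m := by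
      conv_lhs => rw [← htot, Finset.mul_sum]
      rw [Finset.sum_congr rfl fun i _ => hsq i, ← Finset.mul_sum, htot']
    exact (pow_left_inj₀ hcpos'.le hcpos.le two_ne_zero).1 (mul_right_cancel₀ hm.ne' h)
  have hmass : ∀ i, ms i = ms' i := fun i => by
    have := hsq i
    rw [hcc] at this
    exact mul_left_cancel₀ (pow_pos hcpos 2).ne' this
  refine ⟨hmass, fun i => ?_⟩
  induction i using Fin.induction with
  | zero =>
    rw [hc, hc', ← hmass 0] at hcc
    exact ((div_left_inj' (Real.sqrt_pos.2 (hms 0)).ne').1 hcc).symm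
  | succ i ih =>
    have h := congrFun (congrFun hJ i) i
    rw [normStiff_apply, normStiff_apply, ← hmass i] at h
    have hs := inv_ne_zero (Real.sqrt_pos.2 (hms i)).ne'
    have h := mul_left_cancel₀ hs (mul_right_cancel₀ hs h)
    simp only [stiffness, Matrix.of_apply, if_true] at h
    linarith
end

section
/- Let N ≥ 1 and let 0 ≤ λ₁ < λ₂ < ⋯ < λ_N be real numbers. Then there exists a unique N×N persymmetric Jacobi matrix J whose spectrum is exactly {λ₁,…,λ_N} (i.e., the characteristic polynomial of J equals ∏_{j=1}^{N}(X − λ_j)). -/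
open Matrix Polynomial

/-- A real symmetric tridiagonal matrix with strictly negative off-diagonal entries. -/
structure Matrix.IsJacobi {n : ℕ} (J : Matrix (Fin n) (Fin n) ℝ) : Prop where
  apply_comm : ∀ i j, J i j = J j i
  eq_zero : ∀ i j : Fin n, (i : ℕ) + 2 ≤ j → J i j = 0
  neg : ∀ i j : Fin n, (i : ℕ) + 1 = j → J i j < 0

namespace Matrix.IsJacobi

variable {n : ℕ} {J K : Matrix (Fin n) (Fin n) ℝ}

theorem reverse (hJ : J.IsJacobi) : (of fun i j => J i.rev j.rev).IsJacobi where
  apply_comm i j := hJ.apply_comm _ _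
  eq_zero i j h := by
    rw [of_apply, hJ.apply_comm]
    exact hJ.eq_zero _ _ (by rw [Fin.val_rev, Fin.val_rev]; omega)
  neg i j h := by
    rw [of_apply, hJ.apply_comm]
    exact hJ.neg _ _ (by rw [Fin.val_rev, Fin.val_rev]; omega)

/-- An eigenvector of a Jacobi matrix is determined by its first component. -/
theorem eq_zero_of_mulVec_eq {J : Matrix (Fin (n + 1)) (Fin (n + 1)) ℝ} (hJ : J.IsJacobi)
    {x : Fin (n + 1) → ℝ} {μ : ℝ} (hx : J *ᵥ x = μ • x) (h0 : x 0 = 0) : x = 0 := by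
  suffices H : ∀ m : ℕ, ∀ i : Fin (n + 1), (i : ℕ) ≤ m → x i = 0 from
    funext fun i => H i i le_rfl
  intro m
  induction m with
  | zero => intro i hi; rwa [show i = 0 from Fin.ext (by simpa using hi)]
  | succ m ih =>
    intro i hi
    rcases hi.lt_or_eq with hi | hi
    · exact ih i (by omega)
    let k : Fin (n + 1) := ⟨m, by omega⟩
    have hk := congrFun hx k
    rw [Pi.smul_apply, ih k le_rfl, smul_zero, mulVec, dotProduct,
      Finset.sum_eq_single i] at hk
    · exact (mul_eq_zero.1 hk).resolve_left (hJ.neg k i hi.symm).ne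
    · intro j _ hj
      rcases le_or_gt (j : ℕ) m with h | h
      · rw [ih j h, mul_zero]
      · have : (j : ℕ) ≠ i := fun h => hj (Fin.ext h)
        rw [hJ.eq_zero k j (by change m + 2 ≤ j; omega), zero_mul]
    · simp

/-- The powers of a Jacobi matrix are banded. -/
theorem pow_apply_eq_zero (hJ : J.IsJacobi) (k : ℕ) (i j : Fin n) (h : (i : ℕ) + k < j) :
    (J ^ k) i j = 0 := by
  induction k generalizing j with
  | zero => rw [pow_zero, one_apply_ne (by rintro rfl; omega)]
  | succ k ih =>
    rw [pow_succ, mul_apply]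
    refine Finset.sum_eq_zero fun l _ => ?_
    rcases lt_or_ge ((i : ℕ) + k) l with hl | hl
    · rw [ih l hl, zero_mul]
    · rw [hJ.eq_zero l j (by omega), mul_zero]

/-- Uniqueness of the Lanczos reduction: an orthonormal basis in which `diagonal d` is represented
by a Jacobi matrix is determined by its first vector. -/
theorem basis_unique {n : ℕ} {J K E F : Matrix (Fin (n + 1)) (Fin (n + 1)) ℝ}
    {d : Fin (n + 1) → ℝ} (hJ : J.IsJacobi) (hK : K.IsJacobi)
    (hE : E * Eᵀ = 1) (hF : F * Fᵀ = 1) (hJE : E * diagonal d = J * E)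
    (hKF : F * diagonal d = K * F) (h0 : E 0 = F 0) : E = F := by
  have hJ' (i j) : J i j = ∑ l, E i l * d l * E j l := by
    have : J = E * diagonal d * Eᵀ := by rw [hJE, mul_assoc, hE, mul_one]
    rw [this, mul_apply]
    simp only [mul_diagonal, transpose_apply]
  have hK' (i j) : K i j = ∑ l, F i l * d l * F j l := by
    have : K = F * diagonal d * Fᵀ := by rw [hKF, mul_assoc, hF, mul_one]
    rw [this, mul_apply]
    simp only [mul_diagonal, transpose_apply]
  suffices H : ∀ m : ℕ, ∀ i : Fin (n + 1), (i : ℕ) ≤ m → E i = F i from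
    funext fun i => H i i le_rfl
  intro m
  induction m with
  | zero => intro i hi; rwa [show i = 0 from Fin.ext (by simpa using hi)]
  | succ m ih =>
    intro i hi
    rcases hi.lt_or_eq with hi | hi
    · exact ih i (by omega)
    let k : Fin (n + 1) := ⟨m, by omega⟩
    have hkey (l) : J k i * E i l = K k i * F i l := by
      have h : (J * E) k l = (K * F) k l := by
        rw [← hJE, ← hKF, mul_diagonal, mul_diagonal, ih k le_rfl]
      rw [mul_apply, mul_apply, ← Finset.add_sum_erase _ _ (Finset.mem_univ i),
        ← Finset.add_sum_erase _ _ (Finset.mem_univ i)] at h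
      refine add_right_cancel (h.trans ?_)
      congr 1
      refine Finset.sum_congr rfl fun j hj => ?_
      rcases le_or_gt (j : ℕ) m with hm | hm
      · rw [hJ', hK', ih k le_rfl, ih j hm]
      · have : (j : ℕ) ≠ i := fun h => Finset.ne_of_mem_erase hj (Fin.ext h)
        rw [hJ.eq_zero k j (by change m + 2 ≤ j; omega),
          hK.eq_zero k j (by change m + 2 ≤ j; omega), zero_mul, zero_mul]
    have hnE : ∑ l, E i l * E i l = 1 := by simpa [mul_apply] using congrFun₂ hE i i
    have hnF : ∑ l, F i l * F i l = 1 := by simpa [mul_apply] using congrFun₂ hF i i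
    have hsq : J k i * J k i = K k i * K k i := by
      calc J k i * J k i = ∑ l, (J k i * E i l) * (J k i * E i l) := by
            rw [← mul_one (J k i * J k i), ← hnE, Finset.mul_sum]
            exact Finset.sum_congr rfl fun l _ => by ring
        _ = ∑ l, (K k i * F i l) * (K k i * F i l) := by simp_rw [hkey]
        _ = K k i * K k i := by
            rw [← mul_one (K k i * K k i), ← hnF, Finset.mul_sum]
            exact Finset.sum_congr rfl fun l _ => by ring
    have hJneg := hJ.neg k i hi.symm
    have hKneg := hK.neg k i hi.symm
    have heq : J k i = K k i := by nlinarith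
    exact funext fun l => mul_left_cancel₀ hKneg.ne (heq ▸ hkey l)

end Matrix.IsJacobi

/-- The QR decomposition, in its row version. -/
theorem Matrix.exists_lowerTriangular_mul_orthogonal {n : ℕ} (V : Matrix (Fin n) (Fin n) ℝ)
    (hV : V.det ≠ 0) : ∃ L E : Matrix (Fin n) (Fin n) ℝ, V = L * E ∧ E * Eᵀ = 1 ∧
      (∀ i j, i < j → L i j = 0) ∧ ∀ i, 0 < L i i := by
  let f : Fin n → EuclideanSpace ℝ (Fin n) := fun i => WithLp.toLp 2 (V i)
  let b := InnerProductSpace.gramSchmidtOrthonormalBasis (𝕜 := ℝ) (by simp) f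
  let B : Matrix (Fin n) (Fin n) ℝ := of fun i j => b i j
  have hB : B * Bᵀ = 1 := by
    ext i j
    have := orthonormal_iff_ite.1 b.orthonormal j i
    rw [one_apply, mul_apply]
    simpa [B, PiLp.inner_apply, eq_comm] using this
  have hB' : Bᵀ * B = 1 := mul_eq_one_comm.1 hB
  have htri (i j) (hij : i < j) : (V * Bᵀ) i j = 0 := by
    have := InnerProductSpace.gramSchmidtOrthonormalBasis_inv_triangular
      (𝕜 := ℝ) (by simp) f hij
    simpa [mul_apply, PiLp.inner_apply, f, B] using this
  have hdiag (i) : (V * Bᵀ) i i ≠ 0 := by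
    have hdet : (V * Bᵀ).det ≠ 0 := by
      have := congrArg det hB'
      rw [det_mul, det_one] at this
      rw [det_mul]
      exact mul_ne_zero hV (left_ne_zero_of_mul (this.trans_ne one_ne_zero))
    rw [det_of_isLowerTriangular _ (fun i j h => htri _ _ h)] at hdet
    exact Finset.prod_ne_zero_iff.1 hdet i (Finset.mem_univ i)
  let s : Fin n → ℝ := fun i => SignType.sign ((V * Bᵀ) i i)
  have hs (i) : s i * s i = 1 := by
    rcases (hdiag i).lt_or_gt with h | h <;> simp [s, h]
  have hss : diagonal s * diagonal s = 1 := by simp [diagonal_mul_diagonal, hs]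
  refine ⟨V * Bᵀ * diagonal s, diagonal s * B, ?_, ?_, fun i j hij => ?_, fun i => ?_⟩
  · rw [mul_assoc, ← mul_assoc (diagonal s), hss, one_mul, mul_assoc, hB', mul_one]
  · rw [transpose_mul, diagonal_transpose, mul_assoc, ← mul_assoc B, hB, one_mul, hss]
  · rw [mul_diagonal, htri i j hij, zero_mul]
  · rw [mul_diagonal]
    rcases (hdiag i).lt_or_gt with h | h <;> simp [s, h]

/-- The Lanczos reduction: an orthonormal basis in which `diagonal d` is represented by a Jacobi
matrix, obtained by orthonormalizing the Krylov sequence of a given vector `v`. -/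
theorem Matrix.exists_isJacobi_basis {n : ℕ} {d v : Fin (n + 1) → ℝ}
    (hd : Function.Injective d) (hv : ∀ j, v j ≠ 0) :
    ∃ J E : Matrix (Fin (n + 1)) (Fin (n + 1)) ℝ, J.IsJacobi ∧ E * Eᵀ = 1 ∧
      E * diagonal d = J * E ∧ (∃ c : ℝ, c ≠ 0 ∧ v = c • E 0) ∧
      ∀ (x : Fin (n + 1) → ℝ) (i : Fin (n + 1)),
        (∀ k : ℕ, k ≤ i → ∑ j, x j * v j * d j ^ k = 0) → (E *ᵥ x) i = 0 := by
  let V : Matrix (Fin (n + 1)) (Fin (n + 1)) ℝ := of fun i j => v j * (-d j) ^ (i : ℕ)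
  have hV : V.det ≠ 0 := by
    have : Vᵀ = diagonal v * vandermonde (fun j => -d j) := by
      ext i j
      simp [V, vandermonde_apply, diagonal_mul]
    rw [← det_transpose, this, det_mul, det_diagonal]
    exact mul_ne_zero (Finset.prod_ne_zero_iff.2 fun j _ => hv j)
      (det_vandermonde_ne_zero_iff.2 (neg_injective.comp hd))
  obtain ⟨L, E, hLE, hE, hLtri, hLpos⟩ := V.exists_lowerTriangular_mul_orthogonal hV
  have hLdet : L.det ≠ 0 := by
    rw [hLE, det_mul] at hV
    exact left_ne_zero_of_mul hV
  have hML : L⁻¹ * L = 1 := nonsing_inv_mul _ hLdet.isUnit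
  have hMtri (i j) (hij : i < j) : L⁻¹ i j = 0 := by
    have := invertibleOfIsUnitDet L hLdet.isUnit
    exact blockTriangular_inv_of_blockTriangular
      (show BlockTriangular L OrderDual.toDual from fun i j h => hLtri _ _ h) hij
  have hMpos (i) : 0 < L⁻¹ i i := by
    have h := congrFun₂ hML i i
    rw [one_apply_eq, mul_apply, Finset.sum_eq_single i] at h
    · exact pos_of_mul_pos_left (h ▸ one_pos) (hLpos i).le
    · intro j _ hj
      rcases hj.lt_or_gt with hj | hj
      · rw [hLtri j i hj, mul_zero]
      · rw [hMtri i j hj, zero_mul]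
    · simp
  have hEM : E = L⁻¹ * V := by rw [hLE, ← mul_assoc, hML, one_mul]
  have hVE : V * Eᵀ = L := by rw [hLE, mul_assoc, hE, mul_one]
  have hVshift (k i : Fin (n + 1)) (hk : (k : ℕ) < n) :
      (V * diagonal d * Eᵀ) k i = -L ⟨k + 1, by omega⟩ i := by
    rw [← hVE, mul_apply, mul_apply, ← Finset.sum_neg_distrib]
    refine Finset.sum_congr rfl fun j _ => ?_
    simp only [mul_diagonal, V, of_apply, pow_succ]
    ring
  have hJ (i j) : (E * diagonal d * Eᵀ) i j = ∑ k, L⁻¹ i k * (V * diagonal d * Eᵀ) k j := by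
    rw [hEM, mul_assoc L⁻¹, mul_assoc L⁻¹, ← hEM, mul_apply]
  refine ⟨E * diagonal d * Eᵀ, E, ⟨fun i j => ?_, fun i j hij => ?_, fun i j hij => ?_⟩, hE,
    ?_, ⟨L 0 0, (hLpos 0).ne', ?_⟩, fun x i hx => ?_⟩
  · rw [mul_apply, mul_apply]
    simp only [mul_diagonal, transpose_apply]
    exact Finset.sum_congr rfl fun k _ => by ring
  · rw [hJ]
    refine Finset.sum_eq_zero fun k _ => ?_
    rcases le_or_gt k i with hk | hk
    · rw [hVshift k j (by omega), hLtri _ _ (Fin.lt_def.2 (by change (k : ℕ) + 1 < j; omega)),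
        neg_zero, mul_zero]
    · rw [hMtri i k hk, zero_mul]
  · rw [hJ, Finset.sum_eq_single i]
    · rw [hVshift i j (by omega), show (⟨i + 1, by omega⟩ : Fin (n + 1)) = j from Fin.ext hij]
      nlinarith [mul_pos (hMpos i) (hLpos j)]
    · intro k _ hk
      rcases hk.lt_or_gt with hk | hk
      · rw [hVshift k j (by omega), hLtri _ _ (Fin.lt_def.2 (by change (k : ℕ) + 1 < j; omega)),
          neg_zero, mul_zero]
      · rw [hMtri i k hk, zero_mul]
    · simp
  · rw [mul_assoc _ Eᵀ, mul_eq_one_comm.1 hE, mul_one]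
  · ext j
    have h := congrFun₂ hLE 0 j
    rw [mul_apply, Finset.sum_eq_single 0] at h
    · simpa [V] using h
    · intro k _ hk
      rw [hLtri 0 k (Fin.pos_iff_ne_zero.2 hk), zero_mul]
    · simp
  · rw [hEM, ← mulVec_mulVec, mulVec, dotProduct]
    refine Finset.sum_eq_zero fun k _ => ?_
    rcases le_or_gt k i with hk | hk
    · have : (V *ᵥ x) k = 0 := by
        have := hx k hk
        calc (V *ᵥ x) k = (-1) ^ (k : ℕ) * ∑ j, x j * v j * d j ^ (k : ℕ) := by
              rw [mulVec, dotProduct, Finset.mul_sum]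
              refine Finset.sum_congr rfl fun j _ => ?_
              simp only [V, of_apply]
              rw [neg_pow]
              ring
          _ = 0 := by rw [this, mul_zero]
      rw [this, mul_zero]
    · rw [hMtri i k hk, zero_mul]

/-- The product of the differences between the `j`-th node and the other ones. -/
noncomputable def nodeProd {n : ℕ} (d : Fin n → ℝ) (j : Fin n) : ℝ :=
  ∏ k ∈ Finset.univ.erase j, (d j - d k)

theorem nodeProd_ne_zero {n : ℕ} {d : Fin n → ℝ} (hd : Function.Injective d) (j : Fin n) :
    nodeProd d j ≠ 0 :=
  Finset.prod_ne_zero_iff.2 fun _ hk => sub_ne_zero.2 (hd.ne (Finset.ne_of_mem_erase hk).symm)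

theorem sum_pow_div_nodeProd {n : ℕ} {d : Fin (n + 1) → ℝ} (hd : Function.Injective d) {k : ℕ}
    (hk : k < n) : ∑ j, d j ^ k / nodeProd d j = 0 := by
  have h := Lagrange.coeff_eq_sum (s := Finset.univ) (v := d) hd.injOn (P := X ^ k)
    (by rw [degree_X_pow, Finset.card_univ, Fintype.card_fin]
        exact_mod_cast hk.trans n.lt_succ_self)
  simpa [coeff_X_pow, hk.ne', nodeProd, eq_comm] using h

/-- Weights annihilating all polynomials of degree less than `n` on `n + 1` nodes are proportional
to the inverses of the node products. -/
theorem mul_nodeProd_eq_of_sum_eq_zero {n : ℕ} {d y : Fin (n + 1) → ℝ}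
    (hy : ∀ k < n, ∑ j, y j * d j ^ k = 0) (i j : Fin (n + 1)) :
    y i * nodeProd d i = y j * nodeProd d j := by
  rcases eq_or_ne i j with rfl | hij
  · rfl
  let q : ℝ[X] := ∏ k ∈ (Finset.univ.erase i).erase j, (X - C (d k))
  have hji : j ∈ Finset.univ.erase i := Finset.mem_erase.2 ⟨hij.symm, Finset.mem_univ j⟩
  have hn : 1 ≤ n := by
    by_contra! h
    exact hij (Fin.ext (by omega))
  have hdeg : q.natDegree < n := by
    rw [natDegree_prod_of_monic _ _ fun k _ => monic_X_sub_C _]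
    simp [Finset.card_erase_of_mem hji]
    omega
  have hq : ∑ m, y m * q.eval (d m) = 0 := by
    simp_rw [eval_eq_sum_range' hdeg, Finset.mul_sum]
    rw [Finset.sum_comm]
    refine Finset.sum_eq_zero fun k hk => ?_
    rw [← mul_zero (q.coeff k), ← hy k (Finset.mem_range.1 hk), Finset.mul_sum]
    exact Finset.sum_congr rfl fun m _ => by ring
  rw [← Finset.add_sum_erase _ _ (Finset.mem_univ i), ← Finset.add_sum_erase _ _ hji,
    Finset.sum_eq_zero, add_zero] at hq
  · have hi : nodeProd d i = (d i - d j) * q.eval (d i) := by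
      simp only [nodeProd, q, eval_prod, eval_sub, eval_X, eval_C]
      exact (Finset.mul_prod_erase _ _ hji).symm
    have hj : nodeProd d j = (d j - d i) * q.eval (d j) := by
      simp only [nodeProd, q, eval_prod, eval_sub, eval_X, eval_C]
      rw [Finset.erase_right_comm]
      exact (Finset.mul_prod_erase _ _ (Finset.mem_erase.2 ⟨hij, Finset.mem_univ i⟩)).symm
    rw [hi, hj]
    linear_combination (d i - d j) * hq
  · intro m hm
    rw [eval_prod, Finset.prod_eq_zero hm (by simp), mul_zero]

/-- Existence of a persymmetric Jacobi matrix with prescribed simple eigenvalues, together with an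
orthonormal basis diagonalizing it. -/
theorem Matrix.exists_persymmetric_isJacobi {n : ℕ} {d : Fin (n + 1) → ℝ}
    (hd : Function.Injective d) :
    ∃ J E : Matrix (Fin (n + 1)) (Fin (n + 1)) ℝ, J.IsJacobi ∧ E * Eᵀ = 1 ∧
      E * diagonal d = J * E ∧ ∀ i j, J i j = J i.rev j.rev := by
  let v : Fin (n + 1) → ℝ := fun j => √|(nodeProd d j)⁻¹|
  let s : Fin (n + 1) → ℝ := fun j => SignType.sign (nodeProd d j)⁻¹
  have hs (j) : s j * s j = 1 := by
    rcases (inv_ne_zero (nodeProd_ne_zero hd j)).lt_or_gt with h | h <;>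
      simp only [s, h, sign_neg, sign_pos] <;> simp
  have hsv (j) : s j * v j * v j = (nodeProd d j)⁻¹ := by
    rw [mul_assoc, Real.mul_self_sqrt (abs_nonneg _), sign_mul_abs]
  obtain ⟨J, E, hJ, hE, hJE, ⟨c, hc, hcv⟩, hkrylov⟩ := exists_isJacobi_basis hd (v := v)
    fun j => (Real.sqrt_pos.2 (abs_pos.2 (inv_ne_zero (nodeProd_ne_zero hd j)))).ne'
  have hrow (i) : ∑ j, E i j * E i j = 1 := by simpa [mul_apply] using congrFun₂ hE i i
  let x : Fin (n + 1) → ℝ := fun j => s j * E 0 j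
  have hx (i : Fin (n + 1)) (hi : i ≠ Fin.last n) : (E *ᵥ x) i = 0 := by
    refine hkrylov x i fun k hk => ?_
    have hi' := Fin.val_lt_last hi
    suffices h : c * ∑ j, x j * v j * d j ^ k = 0 from (mul_eq_zero.1 h).resolve_left hc
    rw [Finset.mul_sum, ← sum_pow_div_nodeProd hd (hk.trans_lt hi')]
    refine Finset.sum_congr rfl fun j _ => ?_
    have hvj : v j = c * E 0 j := congrFun hcv j
    simp only [div_eq_mul_inv, ← hsv j, x]
    linear_combination (-s j * v j * d j ^ k) * hvj
  let t := (E *ᵥ x) (Fin.last n)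
  have hxt (j) : x j = t * E (Fin.last n) j := by
    have h : Eᵀ *ᵥ (E *ᵥ x) = x := by rw [mulVec_mulVec, mul_eq_one_comm.1 hE, one_mulVec]
    rw [← congrFun h j, mulVec, dotProduct, Finset.sum_eq_single (Fin.last n)]
    · rw [transpose_apply, mul_comm]
    · intro i _ hi
      rw [hx i hi, mul_zero]
    · simp
  have ht : t * t = 1 := by
    calc t * t = ∑ j, x j * x j := by
          rw [← mul_one (t * t), ← hrow (Fin.last n), Finset.mul_sum]
          exact Finset.sum_congr rfl fun j _ => by rw [hxt]; ring
      _ = ∑ j, E 0 j * E 0 j :=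
          Finset.sum_congr rfl fun j _ => by linear_combination (E 0 j * E 0 j) * hs j
      _ = 1 := hrow 0
  let K : Matrix (Fin (n + 1)) (Fin (n + 1)) ℝ := of fun i j => J i.rev j.rev
  let F : Matrix (Fin (n + 1)) (Fin (n + 1)) ℝ := of fun i j => t * s j * E i.rev j
  have hF : F * Fᵀ = 1 := by
    ext i j
    have h := congrFun₂ hE i.rev j.rev
    simp only [mul_apply, one_apply, Fin.rev_inj] at h ⊢
    rw [← h]
    refine Finset.sum_congr rfl fun k _ => ?_
    simp only [F, of_apply, transpose_apply]
    linear_combination (E i.rev k * E j.rev k) * (s k * s k * ht + hs k)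
  have hKF : F * diagonal d = K * F := by
    ext i j
    have h := congrFun₂ hJE i.rev j
    rw [mul_diagonal, mul_apply, ← Equiv.sum_comp Fin.revPerm] at h
    rw [mul_diagonal, mul_apply]
    simp only [F, K, of_apply]
    rw [mul_assoc, h, Finset.mul_sum]
    exact Finset.sum_congr rfl fun k _ => by rw [Fin.revPerm_apply]; ring
  have h0 : E 0 = F 0 := by
    ext j
    simp only [F, of_apply, Fin.rev_zero]
    have := hxt j
    simp only [x] at this
    linear_combination s j * this - E 0 j * hs j
  have hEF := hJ.basis_unique hJ.reverse hE hF hJE hKF h0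
  have hJK : J = K := by
    calc J = E * diagonal d * Eᵀ := by rw [hJE, mul_assoc, hE, mul_one]
      _ = F * diagonal d * Fᵀ := by rw [hEF]
      _ = K := by rw [hKF, mul_assoc, hF, mul_one]
  exact ⟨J, E, hJ, hE, hJE, fun i j => congrFun₂ hJK i j⟩

/-- A persymmetric Jacobi matrix with simple eigenvalues `d` is diagonalized by an orthonormal basis
whose first vector is an explicit function of `d`. -/
theorem Matrix.IsJacobi.exists_basis_of_persymmetric {n : ℕ}
    {J : Matrix (Fin (n + 1)) (Fin (n + 1)) ℝ} {d : Fin (n + 1) → ℝ} (hJ : J.IsJacobi)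
    (hpers : ∀ i j, J i j = J i.rev j.rev) (hd : Function.Injective d)
    (hchar : J.charpoly = ∏ j, (X - C (d j))) :
    ∃ E : Matrix (Fin (n + 1)) (Fin (n + 1)) ℝ, E * Eᵀ = 1 ∧ E * diagonal d = J * E ∧
      ∀ j, E 0 j = √(|nodeProd d j|⁻¹ / ∑ k, |nodeProd d k|⁻¹) := by
  have heig (j) : ∃ u : Fin (n + 1) → ℝ, J *ᵥ u = d j • u ∧ u ⬝ᵥ u = 1 ∧ 0 < u 0 := by
    have hdet : (scalar (Fin (n + 1)) (d j) - J).det = 0 := by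
      rw [← eval_charpoly, hchar, eval_prod, Finset.prod_eq_zero (Finset.mem_univ j) (by simp)]
    obtain ⟨u, hu, hu0⟩ := exists_mulVec_eq_zero_iff.2 hdet
    have hu' : J *ᵥ u = d j • u := by
      rw [sub_mulVec, sub_eq_zero] at hu0
      rw [← hu0]
      ext i
      simp [mulVec_diagonal]
    have h0 : u 0 ≠ 0 := fun h => hu (hJ.eq_zero_of_mulVec_eq hu' h)
    have huu : 0 < u ⬝ᵥ u := lt_of_le_of_ne (Finset.sum_nonneg fun i _ => mul_self_nonneg _)
      (Ne.symm (dotProduct_self_eq_zero.not.2 hu))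
    let a : ℝ := SignType.sign (u 0) / √(u ⬝ᵥ u)
    refine ⟨a • u, by rw [mulVec_smul, hu', smul_comm], ?_, ?_⟩
    · rw [smul_dotProduct, dotProduct_smul, smul_eq_mul, smul_eq_mul, ← mul_assoc]
      have hsgn : (SignType.sign (u 0) : ℝ) * SignType.sign (u 0) = 1 := by
        rcases h0.lt_or_gt with h | h <;> simp [h]
      rw [div_mul_div_comm, hsgn, Real.mul_self_sqrt huu.le, one_div_mul_cancel huu.ne']
    · rw [Pi.smul_apply, smul_eq_mul, div_mul_eq_mul_div, sign_mul_self]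
      exact div_pos (abs_pos.2 h0) (Real.sqrt_pos.2 huu)
  choose u hu hunit hpos using heig
  let E : Matrix (Fin (n + 1)) (Fin (n + 1)) ℝ := of fun i j => u j i
  have hJE : E * diagonal d = J * E := by
    ext i j
    rw [mul_diagonal, mul_comm]
    exact (congrFun (hu j) i).symm
  have hJsymm : Jᵀ = J := by
    ext i j
    exact hJ.apply_comm j i
  have hE' : Eᵀ * E = 1 := by
    ext i j
    change u i ⬝ᵥ u j = _
    rcases eq_or_ne i j with rfl | hij
    · rw [hunit, one_apply_eq]
    · rw [one_apply_ne hij]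
      have h : u i ⬝ᵥ (J *ᵥ u j) = (J *ᵥ u i) ⬝ᵥ u j := by
        rw [dotProduct_mulVec, ← mulVec_transpose, hJsymm]
      rw [hu, hu, dotProduct_smul, smul_dotProduct, smul_eq_mul, smul_eq_mul] at h
      exact (mul_eq_zero.1 (show (d j - d i) * (u i ⬝ᵥ u j) = 0 by linarith)).resolve_left
        (sub_ne_zero.2 (hd.ne hij.symm))
  have hE : E * Eᵀ = 1 := mul_eq_one_comm.1 hE'
  have hlast (j) : u j (Fin.last n) * u j (Fin.last n) = u j 0 * u j 0 := by
    let r : Fin (n + 1) → ℝ := fun i => u j i.rev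
    have hr : J *ᵥ r = d j • r := by
      ext i
      refine Eq.trans ?_ (congrFun (hu j) i.rev)
      rw [mulVec, dotProduct, mulVec, dotProduct, ← Equiv.sum_comp Fin.revPerm]
      refine Finset.sum_congr rfl fun k _ => ?_
      simp only [r, Fin.revPerm_apply, Fin.rev_rev]
      rw [hpers i, Fin.rev_rev]
    have h : u j 0 • r - r 0 • u j = 0 := by
      refine hJ.eq_zero_of_mulVec_eq (μ := d j) ?_ ?_
      · rw [mulVec_sub, mulVec_smul, mulVec_smul, hr, hu, smul_sub, smul_comm, smul_comm (r 0)]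
      · simp [mul_comm]
    have h := congrFun h (Fin.last n)
    simp only [Pi.sub_apply, Pi.smul_apply, smul_eq_mul, r, Fin.rev_last, Fin.rev_zero,
      Pi.zero_apply] at h
    linarith
  have hpow (k : ℕ) : J ^ k = E * diagonal (fun j => d j ^ k) * Eᵀ := by
    induction k with
    | zero => simp [hE]
    | succ k ih =>
      have : (diagonal fun j => d j ^ (k + 1)) = diagonal d * diagonal fun j => d j ^ k := by
        rw [diagonal_mul_diagonal]
        simp_rw [pow_succ']
      rw [pow_succ', ih, this, ← mul_assoc E, hJE]
      simp only [mul_assoc]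
  have hprop := mul_nodeProd_eq_of_sum_eq_zero (d := d) (y := fun j => u j 0 * u j (Fin.last n))
    fun k hk => by
      have h := hJ.pow_apply_eq_zero k 0 (Fin.last n) (by simpa using hk)
      rw [hpow, mul_apply] at h
      rw [← h]
      refine Finset.sum_congr rfl fun j _ => ?_
      rw [mul_diagonal, transpose_apply]
      simp only [E, of_apply]
      ring
  let c := |u 0 0 * u 0 (Fin.last n) * nodeProd d 0|
  have hc (j) : u j 0 * u j 0 = c * |nodeProd d j|⁻¹ := by
    have habs : |u j (Fin.last n)| = u j 0 := by
      rw [(abs_eq_abs.2 (mul_self_eq_mul_self_iff.1 (hlast j))), abs_of_pos (hpos j)]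
    rw [eq_mul_inv_iff_mul_eq₀ (abs_ne_zero.2 (nodeProd_ne_zero hd j))]
    simp only [c]
    rw [hprop 0 j, abs_mul, abs_mul, habs, abs_of_pos (hpos j)]
  have hsum : c * ∑ k, |nodeProd d k|⁻¹ = 1 := by
    rw [Finset.mul_sum]
    simp_rw [← hc]
    simpa [mul_apply, E] using congrFun₂ hE 0 0
  refine ⟨E, hE, hJE, fun j => ?_⟩
  rw [div_eq_inv_mul, ← eq_inv_of_mul_eq_one_left hsum, ← hc, Real.sqrt_mul_self (hpos j).le]
  rfl

/-- Persymmetric inverse eigenvalue theorem (Gladwell, Theorem 4.3.2):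
for any reals `0 ≤ λ₁ < λ₂ < ⋯ < λ_N` there is a unique `N×N` persymmetric
Jacobi matrix (real symmetric positive semidefinite, tridiagonal, with
strictly negative first sub- and super-diagonal entries, symmetric about
its anti-diagonal) whose characteristic polynomial is `∏ⱼ (X − λⱼ)`. -/
theorem persymmetric_jacobi_inverse_eigenvalue (N : ℕ) (hN : 1 ≤ N)
    (lam : Fin N → ℝ) (hlam0 : ∀ j, 0 ≤ lam j) (hmono : StrictMono lam) :
    ∃! J : Matrix (Fin N) (Fin N) ℝ,
      J.IsSymm ∧
      J.PosSemidef ∧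
      (∀ i j : Fin N, (i : ℕ) + 2 ≤ (j : ℕ) ∨ (j : ℕ) + 2 ≤ (i : ℕ) →
        J i j = 0) ∧
      (∀ i j : Fin N, (i : ℕ) + 1 = (j : ℕ) → J i j < 0 ∧ J j i < 0) ∧
      (∀ i j : Fin N, J i j = J j.rev i.rev) ∧
      J.charpoly = ∏ j, (X - C (lam j)) := by

  obtain ⟨n, rfl⟩ : ∃ n, N = n + 1 := ⟨N - 1, by omega⟩
  have hinj := hmono.injective
  obtain ⟨J, E, hJ, hE, hJE, hpers⟩ := exists_persymmetric_isJacobi hinj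
  have hJeq : J = E * diagonal lam * Eᵀ := by rw [hJE, mul_assoc, hE, mul_one]
  have hJchar : J.charpoly = ∏ j, (X - C (lam j)) := by
    rw [hJeq, mul_assoc, charpoly_mul_comm, mul_assoc, mul_eq_one_comm.1 hE, mul_one,
      charpoly_diagonal]
  refine ⟨J, ⟨?_, ?_, fun i j hij => ?_, fun i j hij => ?_, fun i j => ?_, hJchar⟩, ?_⟩
  · exact IsSymm.ext fun i j => hJ.apply_comm j i
  · rw [hJeq, ← conjTranspose_eq_transpose_of_trivial]
    exact (PosSemidef.diagonal hlam0).mul_mul_conjTranspose_same E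
  · rcases hij with hij | hij
    · exact hJ.eq_zero i j hij
    · rw [hJ.apply_comm, hJ.eq_zero j i hij]
  · exact ⟨hJ.neg i j hij, hJ.apply_comm i j ▸ hJ.neg i j hij⟩
  · rw [hpers, hJ.apply_comm]
  · rintro K ⟨hKsymm, -, hKtri, hKneg, hKpers, hKchar⟩
    have hK : K.IsJacobi := ⟨fun i j => hKsymm.apply j i, fun i j h => hKtri i j (.inl h),
      fun i j h => (hKneg i j h).1⟩
    obtain ⟨F, hF, hJF, hF0⟩ := hJ.exists_basis_of_persymmetric hpers hinj hJchar
    obtain ⟨G, hG, hKG, hG0⟩ := hK.exists_basis_of_persymmetric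
      (fun i j => by rw [hKpers, hK.apply_comm]) hinj hKchar
    have hFG : G = F := hK.basis_unique hJ hG hF hKG hJF
      (funext fun j => (hG0 j).trans (hF0 j).symm)
    calc K = G * diagonal lam * Gᵀ := by rw [hKG, mul_assoc, hG, mul_one]
      _ = F * diagonal lam * Fᵀ := by rw [hFG]
      _ = J := by rw [hJF, mul_assoc, hF, mul_one]
end

section
/- Let L > 0, let N = 5, let the masses be (m₁,…,m₅) = (5/21, 5/28, 1/6, 5/28, 5/21) and the spring constants be (k₁,…,k₆) = (π²/L²)·(25/42, 15/14, 5/4, 5/4, 15/14, 25/42), and let M = diag(m₁,…,m₅) and K be the corresponding stiffness matrix. Then the eigenvalues of D⁻¹ K D⁻¹ (with D = diag(√m₁,…,√m₅)) are exactly (kπ/L)² for k = 1,…,5; equivalently, det(K − (kπ/L)² M) = 0 for each k = 1,…,5 and the characteristic polynomial of D⁻¹ K D⁻¹ equals ∏_{k=1}^{5}(X − (kπ/L)²). -/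
open Matrix Polynomial Real

/-- The determinant of a `5 × 5` tridiagonal matrix, as a continuant. -/
theorem det_tridiagonal_five {R : Type*} [CommRing R] (a₁ a₂ a₃ a₄ a₅ b₁ b₂ b₃ b₄ c₁ c₂ c₃ c₄ : R) :
    !![a₁, b₁, 0, 0, 0; c₁, a₂, b₂, 0, 0; 0, c₂, a₃, b₃, 0; 0, 0, c₃, a₄, b₄;
        0, 0, 0, c₄, a₅].det =
      a₁ * (a₂ * (a₃ * (a₄ * a₅ - b₄ * c₄) - b₃ * c₃ * a₅) - b₂ * c₂ * (a₄ * a₅ - b₄ * c₄)) -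
        b₁ * c₁ * (a₃ * (a₄ * a₅ - b₄ * c₄) - b₃ * c₃ * a₅) := by
  simp [det_succ_row_zero, Fin.sum_univ_succ, Fin.succAbove]
  ring

theorem stiffness_five (ks : Fin 6 → ℝ) :
    stiffness 5 ks =
      !![ks 0 + ks 1, -ks 1, 0, 0, 0; -ks 1, ks 1 + ks 2, -ks 2, 0, 0;
        0, -ks 2, ks 2 + ks 3, -ks 3, 0; 0, 0, -ks 3, ks 3 + ks 4, -ks 4;
        0, 0, 0, -ks 4, ks 4 + ks 5] := by
  ext i j
  fin_cases i <;> fin_cases j <;> simp [stiffness]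

/-- The characteristic determinant `det (K - x M)` of a chain of five beads. -/
theorem det_stiffness_five_sub (ks : Fin 6 → ℝ) (ms : Fin 5 → ℝ) (x : ℝ) :
    (stiffness 5 ks - x • diagonal ms).det =
      !![ks 0 + ks 1 - x * ms 0, -ks 1, 0, 0, 0; -ks 1, ks 1 + ks 2 - x * ms 1, -ks 2, 0, 0;
        0, -ks 2, ks 2 + ks 3 - x * ms 2, -ks 3, 0; 0, 0, -ks 3, ks 3 + ks 4 - x * ms 3, -ks 4;
        0, 0, 0, -ks 4, ks 4 + ks 5 - x * ms 4].det := by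
  rw [stiffness_five]
  congr 1
  ext i j
  fin_cases i <;> fin_cases j <;> simp [diagonal]

/-- The characteristic polynomial of `D⁻¹ K D⁻¹`, evaluated at `x`, is
`(-1) ^ N * det (K - x M) / det M`. -/
theorem eval_charpoly_normStiff (N : ℕ) (ms : Fin N → ℝ) (hms : ∀ i, 0 < ms i)
    (ks : Fin (N + 1) → ℝ) (x : ℝ) :
    (normStiff N ms ks).charpoly.eval x =
      (-1) ^ N * (stiffness N ks - x • diagonal ms).det * ∏ i, (ms i)⁻¹ := by
  have hM : diagonal ms * diagonal (fun i => (ms i)⁻¹) = 1 := by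
    rw [diagonal_mul_diagonal, ← diagonal_one]
    exact congrArg diagonal (funext fun i => mul_inv_cancel₀ (hms i).ne')
  have hD : diagonal (fun i => (√(ms i))⁻¹) * diagonal (fun i => (√(ms i))⁻¹) =
      diagonal (fun i => (ms i)⁻¹) := by
    rw [diagonal_mul_diagonal]
    refine congrArg diagonal (funext fun i => ?_)
    rw [← mul_inv, Real.mul_self_sqrt (hms i).le]
  have hA : scalar (Fin N) x - stiffness N ks * diagonal (fun i => (ms i)⁻¹) =
      -(stiffness N ks - x • diagonal ms) * diagonal (fun i => (ms i)⁻¹) := by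
    rw [neg_sub, sub_mul, smul_mul_assoc, hM, smul_one_eq_diagonal, scalar_apply]
  rw [normStiff, Matrix.mul_assoc, charpoly_mul_comm, Matrix.mul_assoc, hD, eval_charpoly, hA,
    det_mul, det_neg, det_diagonal, Fintype.card_fin]

/-- The characteristic determinant of the five-bead chain factors over `(k π / L) ^ 2`. -/
theorem det_five_bead (s x : ℝ) :
    (stiffness 5 (fun i => s * ![(25 : ℝ) / 42, 15 / 14, 5 / 4, 5 / 4, 15 / 14, 25 / 42] i) -
        x • diagonal ![(5 : ℝ) / 21, 5 / 28, 1 / 6, 5 / 28, 5 / 21]).det =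
      -(5 / 21 * (5 / 28) * (1 / 6) * (5 / 28) * (5 / 21)) *
        ((x - s) * (x - 4 * s) * (x - 9 * s) * (x - 16 * s) * (x - 25 * s)) := by
  rw [det_stiffness_five_sub, det_tridiagonal_five]
  simp
  ring

/-- The paper's explicit five-bead persymmetric chain of total mass 1:
with masses `(5/21, 5/28, 1/6, 5/28, 5/21)` and spring constants
`(π²/L²)·(25/42, 15/14, 5/4, 5/4, 15/14, 25/42)`, the eigenvalues of
`D⁻¹KD⁻¹` are exactly `(kπ/L)²`, `k = 1, …, 5`: each `(kπ/L)²` satisfies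
`det(K − (kπ/L)² M) = 0`, and the characteristic polynomial of `D⁻¹KD⁻¹` is
`∏_{k=1}^{5} (X − (kπ/L)²)`. -/
theorem five_bead_simulacrum (L : ℝ) (hL : 0 < L) :
    (∀ k : Fin 5,
      (stiffness 5
            (fun i => π ^ 2 / L ^ 2 *
              ![(25 : ℝ) / 42, 15 / 14, 5 / 4, 5 / 4, 15 / 14, 25 / 42] i)
          - ((((k : ℕ) + 1 : ℝ) * π / L) ^ 2) •
            Matrix.diagonal ![(5 : ℝ) / 21, 5 / 28, 1 / 6, 5 / 28, 5 / 21]).det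
        = 0) ∧
    (normStiff 5 ![(5 : ℝ) / 21, 5 / 28, 1 / 6, 5 / 28, 5 / 21]
        (fun i => π ^ 2 / L ^ 2 *
          ![(25 : ℝ) / 42, 15 / 14, 5 / 4, 5 / 4, 15 / 14, 25 / 42] i)).charpoly
      = ∏ k : Fin 5, (X - C ((((k : ℕ) + 1 : ℝ) * π / L) ^ 2)) := by
  constructor
  · intro k
    rw [det_five_bead]
    fin_cases k <;> simp <;> ring_nf <;> simp
  · refine Polynomial.funext fun x => ?_
    rw [eval_charpoly_normStiff 5 _ (by intro i; fin_cases i <;> norm_num), det_five_bead]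
    simp [Fin.prod_univ_succ, eval_mul]
    ring
end
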